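/- arXiv:2407.02927 — 2 statements merged into one kernel-verified Lean document; each statement's English description precedes it below -/
import Mathlib

section
/- There exists ε > 0 such that for every 2×2 strictly hyperbolic system of conservation laws satisfying condition C_ε, there exist two continuous functions u⁽¹⁾, u⁽²⁾ ∈ C⁰(ℝ × 𝕋; ℝ²), taking values in V, each a distributional solution of ∂ₜu + ∂ₓ f(u) = 0 on ℝ × 𝕋 (meaning ∫_ℝ ∫_𝕋 (u ∂ₜφ + f(u) ∂ₓφ) dx dt = 0 for all φ ∈ C¹_c(ℝ × 𝕋)), such that u⁽¹⁾(t,x) = u⁽²⁾(t,x) for all t ≤ −2 and all x ∈ 𝕋, yet u⁽¹⁾(0,0) ≠ u⁽²⁾(0,0). -/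
open MeasureTheory

noncomputable section

/-- The state space `ℝ²`, with the Euclidean norm. -/
abbrev E2 : Type := EuclideanSpace ℝ (Fin 2)

/-- Dot product on `ℝ²`. -/
def dot2 (a b : E2) : ℝ := a 0 * b 0 + a 1 * b 1

/-- Determinant of the `2×2` matrix with columns `a, b`. -/
def det2 (a b : E2) : ℝ := a 0 * b 1 - a 1 * b 0

/-- A distributional solution of `∂ₜu + ∂ₓ f(u) = 0` on all of `ℝ × 𝕋`, the torus
`𝕋 = ℝ/ℤ` being realized by `1`-periodic functions on `ℝ`:
`∫_ℝ ∫_𝕋 (u ∂ₜφ + f(u) ∂ₓφ) dx dt = 0` for every `1`-periodic-in-`x` test function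
`φ ∈ C¹` with compact support in time. -/
def IsDistSol (f : E2 → E2) (u : ℝ × ℝ → E2) : Prop :=
  ∀ φ : ℝ × ℝ → ℝ, ContDiff ℝ 1 φ →
    (∀ t x, φ (t, x + 1) = φ (t, x)) →
    (∃ T : ℝ, ∀ t x, T ≤ |t| → φ (t, x) = 0) →
    ∀ i : Fin 2,
      (∫ t : ℝ, ∫ x in Set.Ioc (0 : ℝ) 1,
          (u (t, x) i * fderiv ℝ φ (t, x) (1, 0)
            + f (u (t, x)) i * fderiv ℝ φ (t, x) (0, 1))) = 0


section core
open scoped ContDiff Topology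
variable {E : Type*} [NormedAddCommGroup E] [NormedSpace ℝ E]

/-- One characteristic family of the system. -/
structure Fam (V : Set E) (f : E → E) (Λ : E → ℝ) (r : E → E) : Prop where
  isOpen : IsOpen V
  zero_mem : (0 : E) ∈ V
  hf : ContDiffOn ℝ ∞ f V
  hΛ : ContDiffOn ℝ ∞ Λ V
  hr : ContDiffOn ℝ ∞ r V
  eig : ∀ v ∈ V, fderiv ℝ f v (r v) = Λ v • r v

/-- Curvature vector of the integral curve at `0`. -/
def cD (r : E → E) : E := fderiv ℝ r 0 (r 0)

/-- Direction of the flux defect created by oscillations of the family. -/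
def cC (f : E → E) (Λ : E → ℝ) (r : E → E) : E := Λ 0 • cD r - fderiv ℝ f 0 (cD r)

/-- Genuine nonlinearity coefficient. -/
def cG (Λ : E → ℝ) (r : E → E) : ℝ := fderiv ℝ Λ 0 (r 0)

theorem Fam.second {V : Set E} {f : E → E} {Λ : E → ℝ} {r : E → E} (h : Fam V f Λ r) :
    (fderiv ℝ (fderiv ℝ f) 0 (r 0)) (r 0) = cG Λ r • r 0 + cC f Λ r := by
  have hV : V ∈ 𝓝 (0 : E) := h.isOpen.mem_nhds h.zero_mem
  have hf := h.hf.contDiffAt hV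
  have hΛ := h.hΛ.contDiffAt hV
  have hr := h.hr.contDiffAt hV
  have d1 : HasFDerivAt (fderiv ℝ f) (fderiv ℝ (fderiv ℝ f) 0) 0 :=
    ((hf.fderiv_right (m := 1) (by norm_cast)).differentiableAt (by norm_num)).hasFDerivAt
  have d2 : HasFDerivAt r (fderiv ℝ r 0) 0 := (hr.differentiableAt (by simp)).hasFDerivAt
  have d3 : HasFDerivAt Λ (fderiv ℝ Λ 0) 0 := (hΛ.differentiableAt (by simp)).hasFDerivAt
  have e1 := d1.clm_apply d2
  have e2 := d3.smul d2
  have e3 : (fun v => fderiv ℝ f v (r v)) =ᶠ[𝓝 0] (fun v => Λ v • r v) := by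
    filter_upwards [hV] with v hv using h.eig v hv
  have e4 := (e2.congr_of_eventuallyEq e3).unique e1
  have e5 := congrArg (fun L => L (r 0)) e4
  simp at e5
  simp only [cG, cC, cD]
  rw [eq_sub_of_add_eq' e5.symm]
  abel

theorem taylor2 {V : Set E} {f : E → E} (hVo : IsOpen V) (h0 : (0 : E) ∈ V)
    (hf : ContDiffOn ℝ ∞ f V) {δ : ℝ} (hδ : 0 < δ) :
    ∃ ρ > 0, ∀ u w : E, ‖u‖ ≤ ρ → ‖w‖ ≤ ρ →
      ‖f (u + w) - f u - fderiv ℝ f u w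
        - (1 / 2 : ℝ) • (fderiv ℝ (fderiv ℝ f) 0 w) w‖ ≤ δ * ‖w‖ ^ 2 := by
  have hV : V ∈ 𝓝 (0 : E) := hVo.mem_nhds h0
  have hf0 := hf.contDiffAt hV
  have d1 : HasStrictFDerivAt (fderiv ℝ f) (fderiv ℝ (fderiv ℝ f) 0) 0 :=
    (hf0.fderiv_right (m := 1) (by norm_cast)).hasStrictFDerivAt (by norm_num)
  have o := d1.isLittleO.def hδ
  rw [nhds_prod_eq] at o
  obtain ⟨s, hs, hs'⟩ := (Filter.eventually_prod_self_iff (r := fun x y => ‖fderiv ℝ f x - fderiv ℝ f y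
      - (fderiv ℝ (fderiv ℝ f) 0) (x - y)‖ ≤ δ * ‖x - y‖)).1 o
  obtain ⟨ε, hε, hball⟩ := Metric.mem_nhds_iff.1 (Filter.inter_mem hs hV)
  refine ⟨ε / 3, by positivity, fun u w hu hw => ?_⟩
  have hmem : ∀ t ∈ Set.Icc (0:ℝ) 1, u + t • w ∈ Metric.ball (0:E) ε := by
    intro t ht
    rw [mem_ball_zero_iff]
    calc ‖u + t • w‖ ≤ ‖u‖ + ‖t • w‖ := norm_add_le _ _
      _ ≤ ε/3 + ε/3 := by
        rw [norm_smul, Real.norm_eq_abs, abs_of_nonneg ht.1]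
        have := mul_le_of_le_one_left (norm_nonneg w) ht.2
        linarith
      _ < ε := by linarith
  have hu' : u ∈ Metric.ball (0:E) ε := by simpa using hmem 0 (by simp)
  set B := fderiv ℝ (fderiv ℝ f) 0 with hB
  set h : ℝ → E := fun t => f (u + t • w) - t • fderiv ℝ f u w - (t ^ 2 / 2) • (B w) w with hh
  have hd : ∀ t ∈ Set.Icc (0:ℝ) 1, HasDerivWithinAt h
      ((fderiv ℝ f (u + t • w) - fderiv ℝ f u - B (t • w)) w) (Set.Icc 0 1) t := by
    intro t ht
    have hx := hball (hmem t ht)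
    have a1 : HasFDerivAt f (fderiv ℝ f (u + t • w)) (u + t • w) :=
      ((hf.contDiffAt (hVo.mem_nhds hx.2)).differentiableAt (by simp)).hasFDerivAt
    have a2 : HasDerivAt (fun t : ℝ => u + t • w) w t := by
      simpa using ((hasDerivAt_id t).smul_const w).const_add u
    have a3 := a1.comp_hasDerivAt t a2
    have a4 : HasDerivAt (fun t : ℝ => t • fderiv ℝ f u w) (fderiv ℝ f u w) t := by
      simpa using (hasDerivAt_id t).smul_const (fderiv ℝ f u w)
    have a5 : HasDerivAt (fun t : ℝ => (t ^ 2 / 2) • (B w) w) (t • (B w) w) t := by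
      have : HasDerivAt (fun t : ℝ => t ^ 2 / 2) t t := by
        have := ((hasDerivAt_id t).pow 2).div_const 2
        simpa using this
      exact this.smul_const _
    have := ((a3.sub a4).sub a5).hasDerivWithinAt (s := Set.Icc 0 1)
    rw [sub_apply, sub_apply, map_smul, smul_apply]
    exact this
  have key := norm_image_sub_le_of_norm_deriv_le_segment_01' (C := δ * ‖w‖ ^ 2) hd (by
    intro t ht
    have ht' : t ∈ Set.Icc (0:ℝ) 1 := ⟨ht.1, ht.2.le⟩
    have := hs' (u + t • w) (hball (hmem t ht')).1 u (hball hu').1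
    simp only [add_sub_cancel_left] at this
    calc _ ≤ ‖fderiv ℝ f (u + t • w) - fderiv ℝ f u - B (t • w)‖ * ‖w‖ :=
          ContinuousLinearMap.le_opNorm _ _
      _ ≤ (δ * ‖t • w‖) * ‖w‖ := by gcongr
      _ ≤ (δ * ‖w‖) * ‖w‖ := by
        gcongr
        rw [norm_smul, Real.norm_eq_abs, abs_of_nonneg ht.1]
        exact mul_le_of_le_one_left (norm_nonneg w) ht.2.le
      _ = δ * ‖w‖ ^ 2 := by ring)
  convert key using 2
  simp only [hh]
  simp
  abel

/-- Profile of the perturbation of the state. -/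
def prof (r : E → E) (u : E) (a s : ℝ) : E :=
  (a * s) • r u + (a ^ 2 * (s ^ 2 - 1) / 2) • cD r

set_option maxHeartbeats 1000000 in
theorem Fam.pointwise {V : Set E} {f : E → E} {Λ : E → ℝ} {r : E → E} (h : Fam V f Λ r)
    {δ : ℝ} (hδ : 0 < δ) :
    ∃ r1 > 0, ∀ (u : E) (a s e : ℝ), ‖u‖ ≤ r1 → 0 ≤ a → a ≤ r1 → s ^ 2 ≤ 2 →
      ‖prof r u a s - (a * s) • r 0‖ ≤ δ * a ∧
      ‖(Λ u - e) • prof r u a s - (f (u + prof r u a s) - f u) + (a ^ 2 / 2) • cC f Λ r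
        + (a ^ 2 * s ^ 2 / 2 * cG Λ r + e * a * s) • r 0‖ ≤ δ * (a ^ 2 + a * |e|) := by
  have hV : V ∈ 𝓝 (0 : E) := h.isOpen.mem_nhds h.zero_mem
  have hf := h.hf.contDiffAt hV
  have hΛ := h.hΛ.contDiffAt hV
  have hr := h.hr.contDiffAt hV
  have hB2 := h.second
  set B := fderiv ℝ (fderiv ℝ f) 0 with hB
  set K : ℝ := ‖r 0‖ + ‖cD r‖ + 1 with hK
  have hK1 : 1 ≤ K := by have := norm_nonneg (r 0); have := norm_nonneg (cD r); linarith
  set m : ℝ := 9 * K ^ 2 + 3 * K * ‖B‖ + 1 with hm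
  have hm1 : 1 ≤ m := by
    have := mul_nonneg (by linarith : (0:ℝ) ≤ K) (norm_nonneg B); nlinarith
  set d : ℝ := min (δ / m) 1 with hd
  have hd0 : 0 < d := lt_min (by positivity) one_pos
  have hd1 : d ≤ 1 := min_le_right _ _
  have hdm : d * m ≤ δ := by
    calc d * m ≤ δ / m * m := by gcongr; exact min_le_left _ _
      _ = δ := by field_simp
  have hdδ : d ≤ δ := by nlinarith
  obtain ⟨ρ, hρ, hT⟩ := taylor2 h.isOpen h.zero_mem h.hf (δ := d / 4) (by positivity)
  have c1 : ContinuousAt r 0 := hr.continuousAt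
  have c2 : ContinuousAt (fun u => Λ u • cD r - fderiv ℝ f u (cD r)) 0 := by
    have : ContinuousAt (fderiv ℝ f) 0 :=
      (hf.fderiv_right (m := 1) (by norm_cast)).continuousAt
    exact (hΛ.continuousAt.smul continuousAt_const).sub (this.clm_apply continuousAt_const)
  have n1 := Metric.continuousAt_iff.1 c1 (d / 4) (by positivity)
  have n2 := Metric.continuousAt_iff.1 c2 (d / 4) (by positivity)
  obtain ⟨ε1, hε1, n1⟩ := n1
  obtain ⟨ε2, hε2, n2⟩ := n2
  obtain ⟨ε3, hε3, n3⟩ := Metric.mem_nhds_iff.1 hV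
  refine ⟨min (min (min (ε1 / 2) (ε2 / 2)) (min (ε3 / 2) ρ)) (min (d / K) (ρ / (3 * K))), by positivity, ?_⟩
  intro u a s e hu ha0 ha hs
  simp only [le_min_iff] at hu ha
  obtain ⟨⟨⟨hu1, hu2⟩, hu3, hu4⟩, -⟩ := hu
  obtain ⟨-, ha5, ha6⟩ := ha
  have k1 : ‖r u - r 0‖ ≤ d / 4 := by
    have := n1 (x := u) (by rw [dist_zero_right]; linarith)
    rw [dist_eq_norm] at this; exact this.le
  have k2 : ‖Λ u • cD r - fderiv ℝ f u (cD r) - cC f Λ r‖ ≤ d / 4 := by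
    have := n2 (x := u) (by rw [dist_zero_right]; linarith)
    rw [dist_eq_norm] at this; exact this.le
  have k3 : u ∈ V := n3 (by rw [mem_ball_zero_iff]; linarith)
  have haK : a * K ≤ d := by rwa [le_div_iff₀ (by linarith)] at ha5
  have haK' : 3 * K * a ≤ ρ := by rw [le_div_iff₀ (by linarith)] at ha6; linarith
  have hs1 : |s| ≤ 2 := abs_le.2 ⟨by nlinarith, by nlinarith⟩
  have hs2 : |s ^ 2 - 1| ≤ 1 := abs_le.2 ⟨by nlinarith [sq_nonneg s], by linarith⟩
  have ha1 : a ≤ 1 := by nlinarith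
  have hD : ‖cD r‖ ≤ K := by have := norm_nonneg (r 0); linarith
  have hr0 : ‖r 0‖ ≤ K := by have := norm_nonneg (cD r); linarith
  obtain ⟨w, hw⟩ : ∃ w, w = prof r u a s := ⟨_, rfl⟩
  rw [← hw]
  have q1 : ‖w - (a * s) • r 0‖ ≤ d * a := by
    have : w - (a * s) • r 0 = (a * s) • (r u - r 0) + (a ^ 2 * (s ^ 2 - 1) / 2) • cD r := by
      rw [hw, prof, smul_sub]; abel
    rw [this]
    calc _ ≤ ‖(a * s) • (r u - r 0)‖ + ‖(a ^ 2 * (s ^ 2 - 1) / 2) • cD r‖ := norm_add_le _ _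
      _ = a * |s| * ‖r u - r 0‖ + a ^ 2 * |s ^ 2 - 1| / 2 * ‖cD r‖ := by
        rw [norm_smul, norm_smul]; simp only [Real.norm_eq_abs, abs_mul, abs_div, abs_pow, abs_of_nonneg ha0]
        simp
      _ ≤ a * 2 * (d / 4) + a ^ 2 * 1 / 2 * K := by gcongr
      _ ≤ d * a := by nlinarith
  have q2 : ‖(a * s) • r 0‖ ≤ 2 * K * a := by
    rw [norm_smul, Real.norm_eq_abs, abs_mul, abs_of_nonneg ha0]
    calc a * |s| * ‖r 0‖ ≤ a * 2 * K := by gcongr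
      _ = _ := by ring
  have q3 : ‖w‖ ≤ 3 * K * a := by
    have := norm_add_le (w - (a * s) • r 0) ((a * s) • r 0)
    rw [sub_add_cancel] at this
    nlinarith
  refine ⟨q1.trans (by gcongr), ?_⟩
  have t1 := hT u w hu4 (q3.trans haK')
  set X := f (u + w) - f u - fderiv ℝ f u w - (1 / 2 : ℝ) • (B w) w with hX
  set Y := B w w - B ((a * s) • r 0) ((a * s) • r 0) with hY
  have t2 : ‖Y‖ ≤ ‖B‖ * (d * a) * (5 * K * a) := by
    have : Y = B (w - (a * s) • r 0) w + B ((a * s) • r 0) (w - (a * s) • r 0) := by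
      rw [hY]; simp only [map_sub, sub_apply]; abel
    rw [this]
    calc _ ≤ ‖B‖ * ‖w - (a * s) • r 0‖ * ‖w‖ + ‖B‖ * ‖(a * s) • r 0‖ * ‖w - (a * s) • r 0‖ :=
          (norm_add_le _ _).trans (add_le_add (B.le_opNorm₂ _ _) (B.le_opNorm₂ _ _))
      _ ≤ ‖B‖ * (d * a) * (3 * K * a) + ‖B‖ * (2 * K * a) * (d * a) := by gcongr
      _ = _ := by ring
  have hid : (Λ u - e) • w - (f (u + w) - f u) + (a ^ 2 / 2) • cC f Λ r
        + (a ^ 2 * s ^ 2 / 2 * cG Λ r + e * a * s) • r 0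
      = -X - e • (w - (a * s) • r 0)
        + (a ^ 2 * (s ^ 2 - 1) / 2) • (Λ u • cD r - fderiv ℝ f u (cD r) - cC f Λ r)
        - (1 / 2 : ℝ) • Y := by
    have z1 : fderiv ℝ f u w = (a * s) • (Λ u • r u)
        + (a ^ 2 * (s ^ 2 - 1) / 2) • fderiv ℝ f u (cD r) := by
      rw [hw, prof, map_add, map_smul, map_smul, h.eig u k3]
    have z2 : B ((a * s) • r 0) ((a * s) • r 0)
        = (a * s) • ((a * s) • (cG Λ r • r 0 + cC f Λ r)) := by
      rw [map_smul, map_smul, smul_apply, hB2]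
    rw [hX, hY, z1, z2]
    generalize (B w) w = bw
    generalize f (u + w) = fw
    rw [hw, prof]
    module
  rw [hid]
  calc _ ≤ ‖X‖ + |e| * ‖w - (a * s) • r 0‖
        + a ^ 2 * |s ^ 2 - 1| / 2 * ‖Λ u • cD r - fderiv ℝ f u (cD r) - cC f Λ r‖
        + 1 / 2 * ‖Y‖ := by
        refine (norm_sub_le _ _).trans (add_le_add ((norm_add_le _ _).trans (add_le_add
          ((norm_sub_le _ _).trans (add_le_add ?_ ?_)) ?_)) ?_)
        · rw [norm_neg]
        · rw [norm_smul, Real.norm_eq_abs]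
        · rw [norm_smul]; simp
        · rw [norm_smul]; simp
    _ ≤ d / 4 * (3 * K * a) ^ 2 + |e| * (d * a) + a ^ 2 * 1 / 2 * (d / 4)
        + 1 / 2 * (‖B‖ * (d * a) * (5 * K * a)) := by
        have : ‖X‖ ≤ d / 4 * (3 * K * a) ^ 2 := t1.trans (by gcongr)
        gcongr
    _ ≤ d * m * a ^ 2 + d * (a * |e|) := by
        have hh : 0 ≤ K * ‖B‖ := by positivity
        have : d * m * a ^ 2 + d * (a * |e|) - (d / 4 * (3 * K * a) ^ 2 + |e| * (d * a) + a ^ 2 * 1 / 2 * (d / 4)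
          + 1 / 2 * (‖B‖ * (d * a) * (5 * K * a))) = d * a ^ 2 * (27 / 4 * K ^ 2 + 7 / 8 + 1/2 * (K * ‖B‖)) := by
          rw [hm]; ring
        have h2 : 0 ≤ d * a ^ 2 * (27 / 4 * K ^ 2 + 7 / 8 + 1/2 * (K * ‖B‖)) := by positivity
        linarith
    _ ≤ δ * a ^ 2 + δ * (a * |e|) := by gcongr
    _ = _ := by ring
end core


section core
open scoped ContDiff Topology
variable {E : Type*} [NormedAddCommGroup E] [NormedSpace ℝ E]

/-- time derivative -/
def dT (ψ : ℝ × ℝ → E) (z : ℝ × ℝ) : E := fderiv ℝ ψ z (1, 0)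
/-- space derivative -/
def dX (ψ : ℝ × ℝ → E) (z : ℝ × ℝ) : E := fderiv ℝ ψ z (0, 1)
/-- periodicity in space -/
def Per (ψ : ℝ × ℝ → E) : Prop := ∀ t x, ψ (t, x + 1) = ψ (t, x)
/-- flux defect -/
def Rr (f : E → E) (ψ : ℝ × ℝ → E) (z : ℝ × ℝ) : E := -dT ψ z - f (dX ψ z)

theorem contDiff_dT {ψ : ℝ × ℝ → E} (h : ContDiff ℝ ∞ ψ) : ContDiff ℝ ∞ (dT ψ) :=
  (h.fderiv_right (m := ∞) (by norm_cast)).clm_apply contDiff_const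

theorem contDiff_dX {ψ : ℝ × ℝ → E} (h : ContDiff ℝ ∞ ψ) : ContDiff ℝ ∞ (dX ψ) :=
  (h.fderiv_right (m := ∞) (by norm_cast)).clm_apply contDiff_const

theorem qper_fderiv {ψ : ℝ × ℝ → E} {c : E} (h : ∀ t x, ψ (t, x + 1) = ψ (t, x) + c) (t x : ℝ) :
    fderiv ℝ ψ (t, x + 1) = fderiv ℝ ψ (t, x) := by
  have h1 := fderiv_comp_add_right (𝕜 := ℝ) (f := ψ) (x := (t, x)) ((0, 1) : ℝ × ℝ)
  have h2 : (fun z : ℝ × ℝ => ψ (z + (0, 1))) = fun z => ψ z + c := by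
    ext ⟨t, x⟩; simpa using h t x
  rw [h2, fderiv_add_const] at h1
  simpa using h1.symm

theorem Per.fderiv_eq {ψ : ℝ × ℝ → E} (h : Per ψ) (t x : ℝ) :
    fderiv ℝ ψ (t, x + 1) = fderiv ℝ ψ (t, x) := qper_fderiv (c := 0) (fun t x => by simpa using h t x) t x

theorem Per.dX {ψ : ℝ × ℝ → E} (h : Per ψ) : Per (dX ψ) := fun t x => by
  simp only [_root_.dX, h.fderiv_eq]

theorem Per.dT {ψ : ℝ × ℝ → E} (h : Per ψ) : Per (dT ψ) := fun t x => by
  simp only [_root_.dT, h.fderiv_eq]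

theorem Per.fract {ψ : ℝ × ℝ → E} (h : Per ψ) (t x : ℝ) : ψ (t, x) = ψ (t, Int.fract x) := by
  have : Function.Periodic (fun y => ψ (t, y)) 1 := fun y => h t y
  have h2 := this.sub_int_mul_eq (x := x) ⌊x⌋
  simp only [mul_one] at h2
  rw [Int.fract]; exact h2.symm

theorem bdd_of_per {g : ℝ × ℝ → E} (hc : Continuous g) (hp : Per g) {K0 : ℝ}
    (h0 : ∀ t x, 1 < |t| → ‖g (t, x)‖ ≤ K0) : ∃ K > 0, ∀ z, ‖g z‖ ≤ K := by
  have hK : IsCompact (Set.Icc (-1:ℝ) 1 ×ˢ Set.Icc (0:ℝ) 1) := isCompact_Icc.prod isCompact_Icc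
  obtain ⟨C, hC⟩ := hK.exists_bound_of_continuousOn hc.continuousOn
  refine ⟨max (max C K0) 1, by positivity, ?_⟩
  rintro ⟨t, x⟩
  by_cases ht : 1 < |t|
  · exact (h0 t x ht).trans ((le_max_right _ _).trans (le_max_left _ _))
  · rw [hp.fract]
    refine (hC _ ⟨abs_le.1 (not_lt.1 ht), Int.fract_nonneg x, (Int.fract_lt_one x).le⟩).trans
      ((le_max_left _ _).trans (le_max_left _ _))

theorem osc_hasFDerivAt {S : ℝ → ℝ} {S' : ℝ → ℝ} (hS : ∀ y, HasDerivAt S (S' y) y)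
    {θ : ℝ × ℝ → ℝ} {X : ℝ × ℝ → E} {z : ℝ × ℝ} (hθ : DifferentiableAt ℝ θ z)
    (hX : DifferentiableAt ℝ X z) {l : ℝ} (hl : l ≠ 0) (v : ℝ × ℝ) :
    DifferentiableAt ℝ (fun z => l⁻¹ • (S (l * θ z) • X z)) z ∧
    fderiv ℝ (fun z => l⁻¹ • (S (l * θ z) • X z)) z v
      = (S' (l * θ z) * fderiv ℝ θ z v) • X z + (l⁻¹ * S (l * θ z)) • fderiv ℝ X z v := by
  have h1 : HasFDerivAt (fun z => l * θ z) (l • fderiv ℝ θ z) z := hθ.hasFDerivAt.const_mul l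
  have h2 := (hS (l * θ z)).comp_hasFDerivAt z h1
  have h3 := (h2.smul hX.hasFDerivAt).const_smul l⁻¹
  have h4 : HasFDerivAt (fun z => l⁻¹ • (S (l * θ z) • X z)) _ z := h3
  refine ⟨h4.differentiableAt, ?_⟩
  rw [h4.fderiv]
  simp [smul_smul]
  rw [add_comm]
  congr 2
  field_simp

theorem fderiv_zero_of_zero {a : ℝ × ℝ → ℝ} (ha0 : ∀ z, 0 ≤ a z) {z : ℝ × ℝ} (hz : a z = 0) :
    fderiv ℝ a z = 0 := by
  apply IsLocalMin.fderiv_eq_zero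
  filter_upwards with y
  rw [hz]; exact ha0 y

/-- oscillation profiles -/
def S1 (y : ℝ) : ℝ := √2 / (2 * Real.pi) * Real.sin (2 * Real.pi * y)
def S1' (y : ℝ) : ℝ := √2 * Real.cos (2 * Real.pi * y)
def S2 (y : ℝ) : ℝ := 1 / (8 * Real.pi) * Real.sin (4 * Real.pi * y)

theorem S1_deriv (y : ℝ) : HasDerivAt S1 (S1' y) y := by
  have h : HasDerivAt (fun y : ℝ => 2 * Real.pi * y) (2 * Real.pi) y := by
    simpa using (hasDerivAt_id y).const_mul (2 * Real.pi)
  have := (h.sin).const_mul (√2 / (2 * Real.pi))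
  refine HasDerivAt.congr_deriv (f := S1) this ?_
  rw [S1']; field_simp

theorem S2_deriv (y : ℝ) : HasDerivAt S2 ((S1' y ^ 2 - 1) / 2) y := by
  have h : HasDerivAt (fun y : ℝ => 4 * Real.pi * y) (4 * Real.pi) y := by
    simpa using (hasDerivAt_id y).const_mul (4 * Real.pi)
  have := (h.sin).const_mul (1 / (8 * Real.pi))
  refine HasDerivAt.congr_deriv (f := S2) this ?_
  rw [S1', mul_pow, Real.sq_sqrt (by norm_num),
    show 4 * Real.pi * y = 2 * (2 * Real.pi * y) by ring, Real.cos_two_mul]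
  field_simp; ring

theorem S1'_sq (y : ℝ) : S1' y ^ 2 ≤ 2 := by
  rw [S1', mul_pow, Real.sq_sqrt (by norm_num)]
  nlinarith [Real.cos_sq_le_one (2 * Real.pi * y)]

theorem S1_abs (y : ℝ) : |S1 y| ≤ 1 := by
  rw [S1, abs_mul]
  have h2 : |√2 / (2 * Real.pi)| ≤ 1 := by
    rw [abs_of_nonneg (by positivity), div_le_one (by positivity)]
    nlinarith [Real.pi_gt_three, Real.sq_sqrt (show (0:ℝ) ≤ 2 by norm_num), Real.sqrt_nonneg 2]
  exact mul_le_one₀ h2 (abs_nonneg _) (Real.abs_sin_le_one _)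

theorem S2_abs (y : ℝ) : |S2 y| ≤ 1 := by
  rw [S2, abs_mul]
  have h2 : |1 / (8 * Real.pi)| ≤ 1 := by
    rw [abs_of_nonneg (by positivity), div_le_one (by positivity)]
    nlinarith [Real.pi_gt_three]
  exact mul_le_one₀ h2 (abs_nonneg _) (Real.abs_sin_le_one _)

theorem S1_per (y : ℝ) (n : ℕ) : S1 (y + n) = S1 y := by
  rw [S1, S1, show 2 * Real.pi * (y + n) = 2 * Real.pi * y + n * (2 * Real.pi) by ring,
    Real.sin_add_nat_mul_two_pi]

theorem S2_per (y : ℝ) (n : ℕ) : S2 (y + n) = S2 y := by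
  rw [S2, S2, show 4 * Real.pi * (y + n) = 4 * Real.pi * y + (2 * n : ℕ) * (2 * Real.pi) by push_cast; ring,
    Real.sin_add_nat_mul_two_pi]

theorem S1_contDiff : ContDiff ℝ ∞ S1 := by
  unfold S1; fun_prop
theorem S2_contDiff : ContDiff ℝ ∞ S2 := by
  unfold S2; fun_prop

set_option maxHeartbeats 1000000 in
theorem Fam.wave {V : Set E} {f : E → E} {Λ : E → ℝ} {r : E → E} (h : Fam V f Λ r)
    {δ : ℝ} (hδ : 0 < δ) :
    ∃ r1 > 0, ∀ ψ : ℝ × ℝ → E, ContDiff ℝ ∞ ψ → Per ψ → (∀ z, ‖dX ψ z‖ ≤ r1) →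
      ∀ a : ℝ × ℝ → ℝ, ContDiff ℝ ∞ a → Per a → (∀ z, 0 ≤ a z) → (∀ z, a z ≤ r1) →
      (∀ t x, 1 ≤ |t| → a (t, x) = 0) →
      ∀ θ : ℝ × ℝ → ℝ, ContDiff ℝ ∞ θ → (∀ t x, θ (t, x + 1) = θ (t, x) + 1) →
      (∀ z, 0 < dX θ z) → ∀ η > 0, ∃ ψ' : ℝ × ℝ → E, ContDiff ℝ ∞ ψ' ∧ Per ψ' ∧
      (∀ z, a z = 0 → ψ' z = ψ z ∧ fderiv ℝ ψ' z = fderiv ℝ ψ z) ∧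
      ∀ z, ∃ s : ℝ, s ^ 2 ≤ 2 ∧ ‖dX ψ' z - dX ψ z - (a z * s) • r 0‖ ≤ δ * a z + η ∧
        ‖Rr f ψ' z - Rr f ψ z + (a z ^ 2 / 2) • cC f Λ r
          + (a z ^ 2 * s ^ 2 / 2 * cG Λ r
              + (dT θ z / dX θ z + Λ (dX ψ z)) * a z * s) • r 0‖
          ≤ δ * (a z ^ 2 + a z * |dT θ z / dX θ z + Λ (dX ψ z)|) + η := by
  have hV : V ∈ 𝓝 (0 : E) := h.isOpen.mem_nhds h.zero_mem
  obtain ⟨r2, hr2, hpw⟩ := h.pointwise hδ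
  obtain ⟨Kf, sL, hsL, hLip⟩ :=
    ((h.hf.contDiffAt hV).hasStrictFDerivAt (by simp)).exists_lipschitzOnWith
  obtain ⟨ρ, hρ, hball⟩ := Metric.mem_nhds_iff.1 (Filter.inter_mem hsL hV)
  have hr0 : 0 ≤ ‖r 0‖ := norm_nonneg _
  refine ⟨min r2 (ρ / (4 * (δ + 2 * ‖r 0‖ + 1))), by positivity, ?_⟩
  intro ψ hψ hψp hu a ha hap ha0 ha1 hat θ hθ hθp hθx η hη
  have hu2 : ∀ z, ‖dX ψ z‖ ≤ r2 := fun z => (hu z).trans (min_le_left _ _)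
  have ha2 : ∀ z, a z ≤ r2 := fun z => (ha1 z).trans (min_le_left _ _)
  have hden : 0 < 4 * (δ + 2 * ‖r 0‖ + 1) := by positivity
  have hu3 : ∀ z, ‖dX ψ z‖ ≤ ρ / 4 := fun z => by
    have := (hu z).trans (min_le_right _ _)
    rw [le_div_iff₀ hden] at this
    nlinarith [norm_nonneg (dX ψ z)]
  have ha3 : ∀ z, (δ + 2 * ‖r 0‖) * a z ≤ ρ / 4 := fun z => by
    have := (ha1 z).trans (min_le_right _ _)
    rw [le_div_iff₀ hden] at this
    nlinarith [ha0 z]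
  have huV : ∀ z, dX ψ z ∈ V := fun z => (hball (by
    rw [mem_ball_zero_iff]; linarith [hu3 z])).2
  -- the amplitudes
  have hθxs := contDiff_dX hθ
  have hinv : ContDiff ℝ ∞ (fun z => (dX θ z)⁻¹) := hθxs.inv (fun z => (hθx z).ne')
  have hru : ContDiff ℝ ∞ (fun z => r (dX ψ z)) := h.hr.comp_contDiff (contDiff_dX hψ) huV
  set X0 : ℝ × ℝ → E := fun z => (dX θ z)⁻¹ • r (dX ψ z) with hX0
  set Y0 : ℝ × ℝ → E := fun z => (a z * (dX θ z)⁻¹) • cD r with hY0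
  have hX0s : ContDiff ℝ ∞ X0 := hinv.smul hru
  have hY0s : ContDiff ℝ ∞ Y0 := (ha.mul hinv).smul contDiff_const
  set X : ℝ × ℝ → E := fun z => a z • X0 z with hX
  set Y : ℝ × ℝ → E := fun z => a z • Y0 z with hY
  have hXs : ContDiff ℝ ∞ X := ha.smul hX0s
  have hYs : ContDiff ℝ ∞ Y := ha.smul hY0s
  have gen : ∀ W : ℝ × ℝ → E, ContDiff ℝ ∞ W → ∀ z, a z = 0 →
      fderiv ℝ (fun z => a z • W z) z = 0 := by
    intro W hW z hz
    have h1 := ((ha.differentiable (by simp)) z).hasFDerivAt.smul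
      ((hW.differentiable (by simp)) z).hasFDerivAt
    have h2 : HasFDerivAt (fun z => a z • W z) _ z := h1
    rw [h2.fderiv, hz, fderiv_zero_of_zero ha0 hz]
    refine ContinuousLinearMap.ext fun v => ?_
    simp
  have hθd : Per (dX θ) := fun t x => by simp only [dX, qper_fderiv hθp]
  have hXp : Per X := fun t x => by
    simp only [hX, hX0, hap t x, hθd t x, hψp.dX t x]
  have hYp : Per Y := fun t x => by
    simp only [hY, hY0, hap t x, hθd t x]
  have hbd : ∀ W : ℝ × ℝ → E, ContDiff ℝ ∞ W → Per W →
      (∀ z, a z = 0 → fderiv ℝ W z = 0) →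
      ∃ K > 0, ∀ z, ‖fderiv ℝ W z‖ ≤ K := by
    intro W hW hWp hW0
    obtain ⟨K, hK, hK'⟩ := bdd_of_per (g := fderiv ℝ W) (K0 := 0)
      (hW.continuous_fderiv (by simp)) (fun t x => hWp.fderiv_eq t x)
      (fun t x ht => by rw [hW0 _ (hat t x ht.le)]; simp)
    exact ⟨K, hK, hK'⟩
  obtain ⟨K1, hK1, hXb⟩ := hbd X hXs hXp (gen X0 hX0s)
  obtain ⟨K2, hK2, hYb⟩ := hbd Y hYs hYp (gen Y0 hY0s)
  -- choice of the frequency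
  set η' : ℝ := min (η / (1 + Kf)) (ρ / 4) with hη'
  have hη'0 : 0 < η' := by positivity
  obtain ⟨n, hn⟩ := exists_nat_gt ((K1 + K2) / η')
  have hn0 : (0:ℝ) < n := lt_trans (by positivity) hn
  have hnK : (n:ℝ)⁻¹ * (K1 + K2) ≤ η' := by
    rw [div_lt_iff₀ hη'0] at hn
    rw [inv_mul_le_iff₀ hn0]; linarith
  set G1 : ℝ × ℝ → E := fun z => (n:ℝ)⁻¹ • (S1 (n * θ z) • X z) with hG1
  set G2 : ℝ × ℝ → E := fun z => (n:ℝ)⁻¹ • (S2 (n * θ z) • Y z) with hG2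
  have hG1s : ContDiff ℝ ∞ G1 :=
    contDiff_const.smul ((S1_contDiff.comp (contDiff_const.mul hθ)).smul hXs)
  have hG2s : ContDiff ℝ ∞ G2 :=
    contDiff_const.smul ((S2_contDiff.comp (contDiff_const.mul hθ)).smul hYs)
  have hdθ : Differentiable ℝ θ := hθ.differentiable (by simp)
  have hdX : Differentiable ℝ X := hXs.differentiable (by simp)
  have hdY : Differentiable ℝ Y := hYs.differentiable (by simp)
  have hG1d := fun z v => (osc_hasFDerivAt S1_deriv (hdθ z) (hdX z) hn0.ne' v).2
  have hG2d := fun z v => (osc_hasFDerivAt S2_deriv (hdθ z) (hdY z) hn0.ne' v).2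
  have hsum : ∀ z, fderiv ℝ (fun z => ψ z + (G1 z + G2 z)) z
      = fderiv ℝ ψ z + (fderiv ℝ G1 z + fderiv ℝ G2 z) := by
    intro z
    have e1 := (hψ.differentiable (by simp) z).hasFDerivAt
    have e2 := (hG1s.differentiable (by simp) z).hasFDerivAt
    have e3 := (hG2s.differentiable (by simp) z).hasFDerivAt
    exact (e1.add (e2.add e3)).fderiv
  refine ⟨fun z => ψ z + (G1 z + G2 z), hψ.add (hG1s.add hG2s), ?_, ?_, ?_⟩
  · intro t x
    simp only [hG1, hG2, hψp t x, hXp t x, hYp t x, hθp t x, mul_add, mul_one, S1_per, S2_per]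
  · intro z hz
    have x0 : X z = 0 := by simp [hX, hz]
    have y0 : Y z = 0 := by simp [hY, hz]
    refine ⟨by simp [hG1, hG2, x0, y0], ?_⟩
    rw [hsum]
    refine ContinuousLinearMap.ext fun v => ?_
    have e1 := hG1d z v
    have e2 := hG2d z v
    rw [x0, gen X0 hX0s z hz] at e1
    rw [y0, gen Y0 hY0s z hz] at e2
    simp only [add_apply]
    rw [e1, e2]
    simp
  · intro z
    set s := S1' (n * θ z) with hs
    refine ⟨s, S1'_sq _, ?_⟩
    set er : ℝ × ℝ → E := fun v => ((n:ℝ)⁻¹ * S1 (n * θ z)) • fderiv ℝ X z v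
      + ((n:ℝ)⁻¹ * S2 (n * θ z)) • fderiv ℝ Y z v with her
    have herb : ∀ v : ℝ × ℝ, ‖v‖ ≤ 1 → ‖er v‖ ≤ η' := by
      intro v hv
      have gb : ∀ (T : ℝ) (L : ℝ × ℝ →L[ℝ] E) (K : ℝ), |T| ≤ 1 → ‖L‖ ≤ K →
          ‖((n:ℝ)⁻¹ * T) • L v‖ ≤ (n:ℝ)⁻¹ * K := by
        intro T L K hT hL
        rw [norm_smul, Real.norm_eq_abs, abs_mul, abs_of_pos (inv_pos.2 hn0), mul_assoc]
        have : ‖L v‖ ≤ K := (L.le_opNorm v).trans (by nlinarith [norm_nonneg L])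
        have h3 : |T| * ‖L v‖ ≤ 1 * K := by gcongr
        rw [one_mul] at h3
        gcongr
      calc ‖er v‖ ≤ (n:ℝ)⁻¹ * K1 + (n:ℝ)⁻¹ * K2 :=
            (norm_add_le _ _).trans (add_le_add (gb _ _ _ (S1_abs _) (hXb z)) (gb _ _ _ (S2_abs _) (hYb z)))
        _ ≤ η' := by rw [← mul_add]; exact hnK
    have hv : ∀ v, fderiv ℝ (fun z => ψ z + (G1 z + G2 z)) z v
        = fderiv ℝ ψ z v + (fderiv ℝ θ z v / dX θ z) • prof r (dX ψ z) (a z) s + er v := by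
      intro v
      rw [hsum]
      simp only [add_apply]
      rw [hG1d, hG2d, ← hs]
      simp only [her, hX, hY, hX0, hY0, prof, smul_add, smul_smul]
      have e1 : s * fderiv ℝ θ z v * (a z * (dX θ z)⁻¹) = fderiv ℝ θ z v / dX θ z * (a z * s) := by
        field_simp
      have e2 : (s ^ 2 - 1) / 2 * fderiv ℝ θ z v * (a z * (a z * (dX θ z)⁻¹))
          = fderiv ℝ θ z v / dX θ z * (a z ^ 2 * (s ^ 2 - 1) / 2) := by
        field_simp
      rw [e1, e2]
      abel
    have hvx : dX (fun z => ψ z + (G1 z + G2 z)) z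
        = dX ψ z + prof r (dX ψ z) (a z) s + er (0, 1) := by
      have := hv (0, 1)
      rw [show fderiv ℝ θ z (0, 1) / dX θ z = 1 from div_self (hθx z).ne', one_smul] at this
      exact this
    have hvt : dT (fun z => ψ z + (G1 z + G2 z)) z
        = dT ψ z + (dT θ z / dX θ z) • prof r (dX ψ z) (a z) s + er (1, 0) := hv (1, 0)
    have hex : ‖er (0, 1)‖ ≤ η' := herb _ (by simp [Prod.norm_def])
    have het : ‖er (1, 0)‖ ≤ η' := herb _ (by simp [Prod.norm_def])
    obtain ⟨p1, p2⟩ := hpw (dX ψ z) (a z) s (dT θ z / dX θ z + Λ (dX ψ z)) (hu2 z) (ha0 z) (ha2 z) (S1'_sq _)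
    rw [Rr, hvx, hvt, Rr]
    generalize dT θ z / dX θ z = q at *
    generalize prof r (dX ψ z) (a z) s = w at *
    have hs2 : |s| ≤ 2 := abs_le.2 ⟨by nlinarith [S1'_sq (n * θ z)], by nlinarith [S1'_sq (n * θ z)]⟩
    have hη'η : η' * (1 + Kf) ≤ η := by
      have : η' ≤ η / (1 + Kf) := min_le_left _ _
      rwa [le_div_iff₀ (by positivity)] at this
    have hKf : (0:ℝ) ≤ Kf := Kf.2
    have hη'η2 : η' ≤ η := by nlinarith
    have hη'ρ : η' ≤ ρ / 4 := min_le_right _ _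
    have hw : ‖w‖ ≤ ρ / 4 := by
      have h1 := norm_add_le (w - (a z * s) • r 0) ((a z * s) • r 0)
      rw [sub_add_cancel] at h1
      have h2 : ‖(a z * s) • r 0‖ ≤ a z * 2 * ‖r 0‖ := by
        rw [norm_smul, Real.norm_eq_abs, abs_mul, abs_of_nonneg (ha0 z)]
        have := ha0 z
        gcongr
      nlinarith [ha3 z]
    constructor
    · have : dX ψ z + w + er (0, 1) - dX ψ z - (a z * s) • r 0
        = (w - (a z * s) • r 0) + er (0, 1) := by abel
      rw [this]
      exact (norm_add_le _ _).trans (add_le_add p1 (hex.trans hη'η2))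
    · have m1 : dX ψ z + w ∈ sL := (hball (by
        rw [mem_ball_zero_iff]
        linarith [norm_add_le (dX ψ z) w, hu3 z])).1
      have m2 : dX ψ z + w + er (0, 1) ∈ sL := (hball (by
        rw [mem_ball_zero_iff]
        linarith [norm_add_le (dX ψ z) w, hu3 z, norm_add_le (dX ψ z + w) (er (0, 1))])).1
      have hl := hLip.dist_le_mul _ m2 _ m1
      rw [dist_eq_norm, dist_eq_norm, add_sub_cancel_left] at hl
      have hl' : ‖f (dX ψ z + w + er (0, 1)) - f (dX ψ z + w)‖ ≤ Kf * η' :=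
        hl.trans (by gcongr)
      have : -(dT ψ z + q • w + er (1, 0)) - f (dX ψ z + w + er (0, 1)) - (-dT ψ z - f (dX ψ z))
            + (a z ^ 2 / 2) • cC f Λ r
            + (a z ^ 2 * s ^ 2 / 2 * cG Λ r + (q + Λ (dX ψ z)) * a z * s) • r 0
          = ((Λ (dX ψ z) - (q + Λ (dX ψ z))) • w - (f (dX ψ z + w) - f (dX ψ z))
            + (a z ^ 2 / 2) • cC f Λ r
            + (a z ^ 2 * s ^ 2 / 2 * cG Λ r + (q + Λ (dX ψ z)) * a z * s) • r 0)
            - er (1, 0) - (f (dX ψ z + w + er (0, 1)) - f (dX ψ z + w)) := by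
        module
      rw [this]
      refine (norm_sub_le _ _).trans ?_
      refine (add_le_add ((norm_sub_le _ _).trans (add_le_add p2 het)) hl').trans ?_
      linarith
end core


section core
open scoped ContDiff Topology

theorem smoothTransition_symm (x : ℝ) :
    Real.smoothTransition (1 - x) = 1 - Real.smoothTransition x := by
  have h := Real.smoothTransition.pos_denom x
  unfold Real.smoothTransition
  rw [sub_sub_cancel, eq_sub_iff_add_eq, add_comm (expNegInvGlue (1 - x)), ← add_div,
    add_comm (expNegInvGlue (1 - x)), div_self h.ne']

theorem smoothTransition_cd : ContDiff ℝ ∞ Real.smoothTransition := Real.smoothTransition.contDiff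

theorem window : ∃ Z B : ℝ → ℝ, ContDiff ℝ ∞ Z ∧ ContDiff ℝ ∞ B ∧ (∀ s, 0 ≤ Z s) ∧
    (∀ s, Z s ^ 2 + Z (s + 1 / 2) ^ 2 = 1) ∧ (∀ s, |B s| ≤ 1) ∧ (∀ s, Z s ≠ 0 → deriv B s = 1) := by
  set c : ℝ → ℝ := fun s => Real.cos (2 * Real.pi * s) with hc
  have hcs : ContDiff ℝ ∞ c := by rw [hc]; fun_prop
  set σ : ℝ → ℝ := fun s => Real.sin (2 * Real.pi * s) with hσ
  have hσs : ContDiff ℝ ∞ σ := by rw [hσ]; fun_prop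
  set S := Real.smoothTransition with hS
  have hSs : ContDiff ℝ ∞ S := smoothTransition_cd
  set m : ℝ → ℝ := fun s => 1 + c s + S (-1 / 2 - c s) with hm
  have hms : ContDiff ℝ ∞ m :=
    (contDiff_const.add hcs).add (hSs.comp (contDiff_const.sub hcs))
  have hm0 : ∀ s, m s ≠ 0 := by
    intro s
    have h1 : -1 ≤ c s := Real.neg_one_le_cos _
    have h2 : 0 ≤ S (-1 / 2 - c s) := Real.smoothTransition.nonneg _
    rcases eq_or_lt_of_le h1 with h | h
    · have : 0 < S (-1 / 2 - c s) := Real.smoothTransition.pos_of_pos (by rw [← h]; norm_num)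
      simp only [hm]; linarith
    · simp only [hm]; linarith
  refine ⟨fun s => Real.sin (Real.pi / 2 * S (1 / 2 + c s)),
    fun s => 1 / Real.pi * Real.arctan (σ s / m s), ?_, ?_, ?_, ?_, ?_, ?_⟩
  · exact Real.contDiff_sin.comp (contDiff_const.mul (hSs.comp (contDiff_const.add hcs)))
  · exact contDiff_const.mul (Real.contDiff_arctan.comp (hσs.div hms hm0))
  · intro s
    have h2 : 0 ≤ S (1 / 2 + c s) := Real.smoothTransition.nonneg _
    have h3 : S (1 / 2 + c s) ≤ 1 := Real.smoothTransition.le_one _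
    apply Real.sin_nonneg_of_nonneg_of_le_pi
    · positivity
    · nlinarith [Real.pi_pos]
  · intro s
    have h1 : c (s + 1 / 2) = - c s := by
      simp only [hc]
      rw [show 2 * Real.pi * (s + 1 / 2) = 2 * Real.pi * s + Real.pi by ring, Real.cos_add_pi]
    have h2 : S (1 / 2 + c (s + 1 / 2)) = 1 - S (1 / 2 + c s) := by
      rw [h1, ← smoothTransition_symm]; congr 1; ring
    simp only [h2]
    rw [mul_sub, mul_one, Real.sin_pi_div_two_sub, Real.sin_sq_add_cos_sq]
  · intro s
    have h1 := Real.arctan_lt_pi_div_two (σ s / m s)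
    have h2 := Real.neg_pi_div_two_lt_arctan (σ s / m s)
    rw [abs_mul, abs_of_nonneg (by positivity), one_div, inv_mul_le_iff₀ Real.pi_pos, abs_le]
    constructor <;> linarith [Real.pi_pos]
  · intro s hs
    have h1 : 0 < 1 / 2 + c s := by
      by_contra h
      apply hs
      simp only [hS, Real.smoothTransition.zero_of_nonpos (not_lt.1 h), mul_zero, Real.sin_zero]
    have h2 : ∀ᶠ y in 𝓝 s, 0 < 1 / 2 + c y :=
      (continuousAt_const.add hcs.continuous.continuousAt).eventually (lt_mem_nhds h1)
    have h3 : (fun s => 1 / Real.pi * Real.arctan (σ s / m s)) =ᶠ[𝓝 s]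
        (fun s => 1 / Real.pi * Real.arctan (σ s / (1 + c s))) := by
      filter_upwards [h2] with y hy
      have : S (-1 / 2 - c y) = 0 := Real.smoothTransition.zero_of_nonpos (by linarith)
      simp only [hm, this, add_zero]
    rw [h3.deriv_eq]
    have d0 : HasDerivAt (fun y : ℝ => 2 * Real.pi * y) (2 * Real.pi) s := by
      simpa using (hasDerivAt_id s).const_mul (2 * Real.pi)
    have d1 := d0.sin
    have d2 := d0.cos.const_add 1
    have hne : 1 + c s ≠ 0 := by linarith
    have d3 := ((d1.div d2 hne).arctan).const_mul (1 / Real.pi)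
    have d4 : HasDerivAt (fun s => 1 / Real.pi * Real.arctan (σ s / (1 + c s))) _ s := d3
    rw [d4.deriv]
    have hsq : Real.sin (2 * Real.pi * s) ^ 2 = 1 - c s ^ 2 := by
      simp only [hc]; linarith [Real.sin_sq_add_cos_sq (2 * Real.pi * s)]
    have hpi := Real.pi_pos.ne'
    change 1 / Real.pi * (1 / (1 + (Real.sin (2 * Real.pi * s) / (1 + c s)) ^ 2) *
      ((c s * (2 * Real.pi) * (1 + c s) - Real.sin (2 * Real.pi * s) *
        (-Real.sin (2 * Real.pi * s) * (2 * Real.pi))) / (1 + c s) ^ 2)) = 1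
    have e1 : 1 + (Real.sin (2 * Real.pi * s) / (1 + c s)) ^ 2 = 2 / (1 + c s) := by
      rw [div_pow, hsq]; field_simp; ring
    have e2 : c s * (2 * Real.pi) * (1 + c s) - Real.sin (2 * Real.pi * s) *
        (-Real.sin (2 * Real.pi * s) * (2 * Real.pi)) = 2 * Real.pi * (1 + c s) := by
      linear_combination 2 * Real.pi * hsq
    rw [e1, e2]
    field_simp

set_option maxHeartbeats 1000000 in
theorem phase {L : ℝ × ℝ → ℝ} (hL : ContDiff ℝ ∞ L) (hp : Per L) {K : ℝ} (hK : 0 < K)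
    (hLb : ∀ z, |L z| ≤ K) (hdL : ∀ z, ‖fderiv ℝ L z‖ ≤ K) {η : ℝ} (hη : 0 < η) :
    ∃ (ζ : Bool → ℝ → ℝ) (θ : Bool → ℝ × ℝ → ℝ),
      (∀ b, ContDiff ℝ ∞ (ζ b)) ∧ (∀ b t, 0 ≤ ζ b t) ∧
      (∀ t, ζ true t ^ 2 + ζ false t ^ 2 = 1) ∧
      (∀ b, ContDiff ℝ ∞ (θ b)) ∧ (∀ b t x, θ b (t, x + 1) = θ b (t, x) + 1) ∧
      (∀ b z, 0 < dX (θ b) z) ∧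
      (∀ b z, ζ b z.1 ≠ 0 → |dT (θ b) z / dX (θ b) z + L z| ≤ η) := by
  obtain ⟨Z, B, hZ, hB, hZ0, hZ1, hB1, hBd⟩ := window
  set τ : ℝ := min (1 / (2 * K)) (η / (2 * (K + K ^ 2))) with hτ
  have hτ0 : 0 < τ := by positivity
  have hτ1 : τ * K ≤ 1 / 2 := by
    have : τ ≤ 1 / (2 * K) := min_le_left _ _
    rw [le_div_iff₀ (by positivity)] at this; linarith
  have hτ2 : τ * (K + K ^ 2) ≤ η / 2 := by
    have : τ ≤ η / (2 * (K + K ^ 2)) := min_le_right _ _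
    rw [le_div_iff₀ (by positivity)] at this; linarith
  set sh : Bool → ℝ := fun b => if b then 0 else 1 / 2 with hsh
  set w : Bool → ℝ → ℝ := fun b t => τ⁻¹ * t + sh b with hw
  have hws : ∀ b, ContDiff ℝ ∞ (w b) := fun b => by simp only [hw]; fun_prop
  have hwd : ∀ b t, HasDerivAt (w b) τ⁻¹ t := fun b t => by
    exact (((hasDerivAt_id t).const_mul τ⁻¹).add_const (sh b)).congr_deriv (by simp)
  have hdiff : Differentiable ℝ L := hL.differentiable (by simp)
  have hd : ∀ b z v, fderiv ℝ (fun z : ℝ × ℝ => z.2 - τ * B (w b z.1) * L z) z v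
      = v.2 - (τ * B (w b z.1) * fderiv ℝ L z v + L z * (deriv B (w b z.1) * v.1)) := by
    intro b z v
    have d1 : HasDerivAt (fun t => τ * B (w b t)) (deriv B (w b z.1)) z.1 := by
      have := (((hB.differentiable (by simp)) (w b z.1)).hasDerivAt.comp z.1 (hwd b z.1)).const_mul τ
      refine this.congr_deriv ?_
      field_simp
    have d2 := d1.comp_hasFDerivAt z (hasFDerivAt_fst (𝕜 := ℝ) (E := ℝ) (F := ℝ) (p := z))
    have d3 := (hasFDerivAt_snd (𝕜 := ℝ) (E := ℝ) (F := ℝ) (p := z)).sub (d2.mul (hdiff z).hasFDerivAt)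
    have d4 : HasFDerivAt (fun z : ℝ × ℝ => z.2 - τ * B (w b z.1) * L z) _ z := d3
    rw [d4.fderiv]
    simp
  have hv1 : ∀ z, |fderiv ℝ L z (1, 0)| ≤ K := fun z => by
    have := (fderiv ℝ L z).le_opNorm (1, 0)
    simpa [Prod.norm_def] using this.trans (by simpa [Prod.norm_def] using hdL z)
  have hv2 : ∀ z, |fderiv ℝ L z (0, 1)| ≤ K := fun z => by
    have := (fderiv ℝ L z).le_opNorm (0, 1)
    simpa [Prod.norm_def] using this.trans (by simpa [Prod.norm_def] using hdL z)
  have hβ : ∀ b t, |τ * B (w b t)| ≤ τ := fun b t => by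
    rw [abs_mul, abs_of_pos hτ0]; exact mul_le_of_le_one_right hτ0.le (hB1 _)
  have hx : ∀ b z, 1 / 2 ≤ dX (fun z : ℝ × ℝ => z.2 - τ * B (w b z.1) * L z) z := by
    intro b z
    rw [dX, hd]
    have : |τ * B (w b z.1) * fderiv ℝ L z (0, 1)| ≤ τ * K := by
      rw [abs_mul]; exact mul_le_mul (hβ b _) (hv2 z) (abs_nonneg _) hτ0.le
    have := (abs_le.1 this).2
    simp only [mul_zero, add_zero]
    linarith
  refine ⟨fun b t => Z (w b t), fun b z => z.2 - τ * B (w b z.1) * L z, fun b => hZ.comp (hws b),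
    fun b t => hZ0 _, ?_, ?_, ?_, fun b z => by linarith [hx b z], ?_⟩
  · intro t
    have := hZ1 (τ⁻¹ * t)
    simpa [hw, hsh] using this
  · intro b
    exact contDiff_snd.sub ((contDiff_const.mul (hB.comp ((hws b).comp contDiff_fst))).mul hL)
  · intro b t x
    simp only [hp t x]; ring
  · intro b z hz
    have h1 := hx b z
    have h2 := hBd _ hz
    set D := dX (fun z : ℝ × ℝ => z.2 - τ * B (w b z.1) * L z) z with hD
    have h3 : dT (fun z : ℝ × ℝ => z.2 - τ * B (w b z.1) * L z) z / D + L z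
        = (-(τ * B (w b z.1)) * (fderiv ℝ L z (1, 0) + L z * fderiv ℝ L z (0, 1))) / D := by
      have hD0 : D ≠ 0 := by linarith
      rw [div_add' _ _ _ hD0]
      congr 1
      rw [hD, dT, dX, hd, hd, h2]
      ring
    rw [h3, abs_div, abs_of_pos (by linarith : 0 < D), div_le_iff₀ (by linarith), abs_mul, abs_neg]
    have h4 : |fderiv ℝ L z (1, 0) + L z * fderiv ℝ L z (0, 1)| ≤ K + K ^ 2 := by
      refine (abs_add_le _ _).trans (add_le_add (hv1 z) ?_)
      rw [abs_mul, sq]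
      exact mul_le_mul (hLb z) (hv2 z) (abs_nonneg _) hK.le
    calc _ ≤ τ * (K + K ^ 2) := mul_le_mul (hβ b _) h4 (abs_nonneg _) hτ0.le
      _ ≤ η / 2 := hτ2
      _ ≤ η * D := by nlinarith
end core


section core
open scoped ContDiff Topology
variable {E : Type*} [NormedAddCommGroup E] [NormedSpace ℝ E]

theorem abs_le_of_sq2 {s : ℝ} (hs : s ^ 2 ≤ 2) : |s| ≤ 3 / 2 :=
  abs_le.2 ⟨by nlinarith, by nlinarith⟩

set_option maxHeartbeats 1000000 in
theorem step_arith {a ae ao se so g d C η1 ee eo dl : ℝ} (ha1 : a ≤ 1) (ha0 : 0 ≤ a)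
    (hae : 0 ≤ ae) (hao : 0 ≤ ao) (hsum : ae ^ 2 + ao ^ 2 = a ^ 2) (hse : se ^ 2 ≤ 2)
    (hso : so ^ 2 ≤ 2) (hd0 : 0 ≤ d) (hd1 : d ≤ 1) (hC : 1 ≤ C) (hη1 : 0 ≤ η1)
    (hee : ae * |ee| ≤ ae * η1) (heo : ao * |eo| ≤ ao * (η1 + dl))
    (hdl : dl ≤ ae * |se| * |g| + d * C * ae + C * η1) :
    |ae ^ 2 * se ^ 2 / 2 * g + ee * ae * se + (ao ^ 2 * so ^ 2 / 2 * g + eo * ao * so)|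
        ≤ (2 * |g| + d * C) * a ^ 2 + (4 * C + 4) * η1 ∧
    d * (ae ^ 2 + ae * |ee|) + d * (ao ^ 2 + ao * |eo|) ≤ d * (1 + |g| + C) * a ^ 2 + (2 * C + 3) * η1 := by
  have hg := abs_nonneg g
  have haea : ae ≤ a := by nlinarith
  have haoa : ao ≤ a := by nlinarith
  have hse' := abs_le_of_sq2 hse
  have hso' := abs_le_of_sq2 hso
  have hse0 := abs_nonneg se
  have hso0 := abs_nonneg so
  have hss : |se| * |so| ≤ 2 := by
    nlinarith [sq_abs se, sq_abs so, sq_nonneg (|se| - |so|)]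
  have hp : 2 * (ae * ao) ≤ a ^ 2 := by nlinarith [sq_nonneg (ae - ao)]
  have hpn : 0 ≤ ae * ao := by positivity
  have b1 : |ae ^ 2 * se ^ 2 / 2 * g| ≤ ae ^ 2 * |g| := by
    rw [abs_mul, abs_of_nonneg (by positivity)]
    gcongr
    nlinarith [sq_nonneg ae]
  have b2 : |ao ^ 2 * so ^ 2 / 2 * g| ≤ ao ^ 2 * |g| := by
    rw [abs_mul, abs_of_nonneg (by positivity)]
    gcongr
    nlinarith [sq_nonneg ao]
  have b3 : |ee * ae * se| ≤ 2 * η1 := by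
    rw [abs_mul, abs_mul, abs_of_nonneg hae]
    calc |ee| * ae * |se| = (ae * |ee|) * |se| := by ring
      _ ≤ (ae * η1) * |se| := by gcongr
      _ ≤ (1 * η1) * 2 := by
          gcongr <;> linarith
      _ = _ := by ring
  have c1 : ao * |eo| ≤ (ae * ao) * |se| * |g| + d * C * (ae * ao) + (C + 1) * η1 := by
    calc ao * |eo| ≤ ao * (η1 + (ae * |se| * |g| + d * C * ae + C * η1)) :=
          heo.trans (by gcongr)
      _ = (ae * ao) * |se| * |g| + d * C * (ae * ao) + ao * ((C + 1) * η1) := by ring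
      _ ≤ _ := by
        have : ao * ((C + 1) * η1) ≤ 1 * ((C + 1) * η1) := by gcongr; linarith
        linarith
  have b4 : |eo * ao * so| ≤ a ^ 2 * |g| + d * C * a ^ 2 + 2 * (C + 1) * η1 := by
    rw [abs_mul, abs_mul, abs_of_nonneg hao]
    have hdC : 0 ≤ d * C := by positivity
    calc |eo| * ao * |so| = (ao * |eo|) * |so| := by ring
      _ ≤ ((ae * ao) * |se| * |g| + d * C * (ae * ao) + (C + 1) * η1) * |so| := by gcongr
      _ = (ae * ao) * |g| * (|se| * |so|) + (d * C * (ae * ao) + (C + 1) * η1) * |so| := by ring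
      _ ≤ (ae * ao) * |g| * 2 + (d * C * (ae * ao) + (C + 1) * η1) * 2 := by
        gcongr; linarith
      _ = (2 * (ae * ao)) * |g| + d * C * (2 * (ae * ao)) + 2 * (C + 1) * η1 := by ring
      _ ≤ _ := by gcongr
  constructor
  · have t1 := abs_add_le (ae ^ 2 * se ^ 2 / 2 * g + ee * ae * se) (ao ^ 2 * so ^ 2 / 2 * g + eo * ao * so)
    have t2 := abs_add_le (ae ^ 2 * se ^ 2 / 2 * g) (ee * ae * se)
    have t3 := abs_add_le (ao ^ 2 * so ^ 2 / 2 * g) (eo * ao * so)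
    have t4 : ae ^ 2 * |g| + ao ^ 2 * |g| = a ^ 2 * |g| := by rw [← add_mul, hsum]
    have t5 : 0 ≤ C * η1 := by positivity
    linarith
  · have hx : ae * ao * |se| * |g| ≤ a ^ 2 * |g| := by
      have : ae * ao * |se| ≤ a ^ 2 :=
        calc ae * ao * |se| ≤ ae * ao * 2 := by gcongr; linarith
          _ ≤ a ^ 2 := by linarith
      gcongr
    have hy : d * C * (ae * ao) ≤ C * a ^ 2 := by
      have : d * C ≤ C := by nlinarith
      calc d * C * (ae * ao) ≤ C * (ae * ao) := by gcongr
        _ ≤ C * a ^ 2 := by gcongr; linarith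
    have hz : ae * |ee| ≤ η1 := hee.trans (mul_le_of_le_one_left hη1 (by linarith))
    calc d * (ae ^ 2 + ae * |ee|) + d * (ao ^ 2 + ao * |eo|)
        = d * (a ^ 2 + (ae * |ee| + ao * |eo|)) := by rw [← hsum]; ring
      _ ≤ d * (a ^ 2 + (η1 + (a ^ 2 * |g| + C * a ^ 2 + (C + 1) * η1))) := by
        gcongr; linarith
      _ = d * (1 + |g| + C) * a ^ 2 + d * ((C + 2) * η1) := by ring
      _ ≤ d * (1 + |g| + C) * a ^ 2 + 1 * ((C + 2) * η1) := by gcongr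
      _ ≤ _ := by
        have : (C + 2) * η1 ≤ (2 * C + 3) * η1 := by gcongr <;> linarith
        linarith

set_option maxHeartbeats 2000000 in
theorem Fam.step {V : Set E} {f : E → E} {Λ : E → ℝ} {r : E → E} (h : Fam V f Λ r)
    {δ : ℝ} (hδ : 0 < δ) :
    ∃ r1 > 0, ∀ ψ : ℝ × ℝ → E, ContDiff ℝ ∞ ψ → Per ψ → (∀ z, ‖dX ψ z‖ ≤ r1) →
      (∀ t x, 1 ≤ |t| → dX ψ (t, x) = 0) →
      ∀ a : ℝ × ℝ → ℝ, ContDiff ℝ ∞ a → Per a → (∀ z, 0 ≤ a z) → (∀ z, a z ≤ r1) →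
      (∀ t x, 1 ≤ |t| → a (t, x) = 0) →
      ∀ η > 0, ∃ ψ' : ℝ × ℝ → E, ContDiff ℝ ∞ ψ' ∧ Per ψ' ∧
      (∀ z, a z = 0 → ψ' z = ψ z ∧ fderiv ℝ ψ' z = fderiv ℝ ψ z) ∧
      ∀ z, ‖dX ψ' z - dX ψ z‖ ≤ (3 * ‖r 0‖ + 1) * a z + η ∧
        ∃ γ : ℝ, |γ| ≤ (2 * |cG Λ r| + δ) * a z ^ 2 + η ∧
        ‖Rr f ψ' z - Rr f ψ z + (a z ^ 2 / 2) • cC f Λ r + γ • r 0‖ ≤ δ * a z ^ 2 + η := by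
  have hV : V ∈ 𝓝 (0 : E) := h.isOpen.mem_nhds h.zero_mem
  set g := cG Λ r with hg
  set N := ‖r 0‖ with hN
  have hN0 : 0 ≤ N := norm_nonneg _
  set DΛ := fderiv ℝ Λ 0 with hDΛ
  set C : ℝ := ‖DΛ‖ + 2 * N + 2 with hC
  have hC1 : 1 ≤ C := by have := norm_nonneg DΛ; linarith
  have hg0 := abs_nonneg g
  set d : ℝ := min (1 / 2) (δ / (1 + |g| + C)) with hd
  have hd0 : 0 < d := by positivity
  have hd1 : d ≤ 1 / 2 := min_le_left _ _
  have hdδ : d * (1 + |g| + C) ≤ δ := by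
    have : d ≤ δ / (1 + |g| + C) := min_le_right _ _
    rwa [le_div_iff₀ (by positivity)] at this
  have hdC : d * C ≤ δ := by nlinarith
  obtain ⟨rw', hrw, hwave⟩ := h.wave hd0
  have hst : HasStrictFDerivAt Λ DΛ 0 := (h.hΛ.contDiffAt hV).hasStrictFDerivAt (by simp)
  have o := hst.isLittleO.def hd0
  rw [nhds_prod_eq] at o
  obtain ⟨s, hs, hs'⟩ := (Filter.eventually_prod_self_iff (r := fun x y => ‖Λ x - Λ y
      - DΛ (x - y)‖ ≤ d * ‖x - y‖)).1 o
  obtain ⟨ρ, hρ, hball⟩ := Metric.mem_nhds_iff.1 (Filter.inter_mem hs hV)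
  set rm := min rw' (ρ / 2) with hrm
  have hrm0 : 0 < rm := by positivity
  refine ⟨min 1 (rm / (2 * (2 * N + 2))), by positivity, ?_⟩
  intro ψ hψ hψp hu hut a ha hap ha0 ha1 hat η hη
  have har : ∀ z, (2 * N + 2) * a z ≤ rm / 2 := fun z => by
    have := (ha1 z).trans (min_le_right _ _)
    rw [le_div_iff₀ (by positivity)] at this; linarith
  have hur : ∀ z, (2 * N + 2) * ‖dX ψ z‖ ≤ rm / 2 := fun z => by
    have := (hu z).trans (min_le_right _ _)
    rw [le_div_iff₀ (by positivity)] at this; linarith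
  have ha1' : ∀ z, a z ≤ 1 := fun z => (ha1 z).trans (min_le_left _ _)
  have hurm : ∀ z, ‖dX ψ z‖ ≤ rm := fun z => by nlinarith [hur z, norm_nonneg (dX ψ z)]
  have harm : ∀ z, a z ≤ rm := fun z => by nlinarith [har z, ha0 z]
  have hrmw : rm ≤ rw' := min_le_left _ _
  have hrmρ : rm < ρ := by have : rm ≤ ρ / 2 := min_le_right _ _; linarith
  have huV : ∀ z, dX ψ z ∈ V := fun z =>
    (hball (by rw [mem_ball_zero_iff]; linarith [hurm z])).2
  set η1 := min (η / (4 * C + 10)) (rm / 4) with hη1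
  have hη10 : 0 < η1 := by positivity
  have hη1η : η1 * (4 * C + 10) ≤ η := by
    have : η1 ≤ η / (4 * C + 10) := min_le_left _ _
    rwa [le_div_iff₀ (by positivity)] at this
  have hη1r : η1 ≤ rm / 4 := min_le_right _ _
  -- the speed
  set L : ℝ × ℝ → ℝ := fun z => Λ (dX ψ z) with hL
  have hLs : ContDiff ℝ ∞ L := h.hΛ.comp_contDiff (contDiff_dX hψ) huV
  have hLp : Per L := fun t x => by simp only [hL, hψp.dX t x]
  have hLc : ∀ t x, 1 ≤ |t| → L (t, x) = Λ 0 := fun t x ht => by simp only [hL, hut t x ht]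
  obtain ⟨K1, hK1, hLb⟩ := bdd_of_per (g := L) (K0 := |Λ 0|) hLs.continuous hLp
    (fun t x ht => by rw [hLc t x ht.le]; simp)
  obtain ⟨K2, hK2, hLd⟩ := bdd_of_per (g := fderiv ℝ L) (K0 := 0)
    (hLs.continuous_fderiv (by simp)) (fun t x => hLp.fderiv_eq t x) (fun t x ht => by
      have : L =ᶠ[𝓝 (t, x)] fun _ => Λ 0 := by
        have hc : ContinuousAt (fun z : ℝ × ℝ => |z.1|) (t, x) := by fun_prop
        filter_upwards [hc.eventually (lt_mem_nhds ht)] with z hz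
        exact hLc z.1 z.2 hz.le
      rw [this.fderiv_eq]; simp)
  obtain ⟨ζ, θ, hζ, hζ0, hζ1, hθ, hθp, hθx, hθe⟩ := phase hLs hLp (K := max K1 K2)
    (by positivity) (fun z => (hLb z).trans (le_max_left _ _))
    (fun z => (hLd z).trans (le_max_right _ _)) hη10
  -- amplitudes
  have hζle : ∀ b t, ζ b t ≤ 1 := by
    intro b t
    have := hζ1 t
    cases b <;> nlinarith [sq_nonneg (ζ true t), sq_nonneg (ζ false t)]
  set A : Bool → ℝ × ℝ → ℝ := fun b z => ζ b z.1 * a z with hA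
  have hAs : ∀ b, ContDiff ℝ ∞ (A b) := fun b => ((hζ b).comp contDiff_fst).mul ha
  have hAp : ∀ b, Per (A b) := fun b t x => by simp only [hA, hap t x]
  have hA0 : ∀ b z, 0 ≤ A b z := fun b z => mul_nonneg (hζ0 _ _) (ha0 z)
  have hAa : ∀ b z, A b z ≤ a z := fun b z => mul_le_of_le_one_left (ha0 z) (hζle _ _)
  have hAt : ∀ b t x, 1 ≤ |t| → A b (t, x) = 0 := fun b t x ht => by
    simp only [hA, hat t x ht, mul_zero]
  have hAz : ∀ b z, a z = 0 → A b z = 0 := fun b z hz => by simp only [hA, hz, mul_zero]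
  have hA2 : ∀ z, A true z ^ 2 + A false z ^ 2 = a z ^ 2 := fun z => by
    simp only [hA, mul_pow, ← add_mul, hζ1, one_mul]
  obtain ⟨ψ1, hψ1, hψ1p, hψ1z, hψ1e⟩ := hwave ψ hψ hψp (fun z => (hurm z).trans hrmw) (A true)
    (hAs _) (hAp _) (hA0 _) (fun z => ((hAa _ z).trans (harm z)).trans hrmw) (hAt _)
    (θ true) (hθ _) (hθp _) (hθx _) η1 hη10
  have hdiff : ∀ {s : ℝ} {b : ℝ} {x : E}, s ^ 2 ≤ 2 → 0 ≤ b → ‖x - (b * s) • r 0‖ ≤ d * b + η1 →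
      ‖x‖ ≤ (3 / 2 * N + d) * b + η1 := by
    intro s b x hs hb hx
    have h1 := norm_add_le (x - (b * s) • r 0) ((b * s) • r 0)
    rw [sub_add_cancel] at h1
    have h2 : ‖(b * s) • r 0‖ ≤ b * (3 / 2) * N := by
      rw [norm_smul, Real.norm_eq_abs, abs_mul, abs_of_nonneg hb]
      have := abs_le_of_sq2 hs
      gcongr
    linarith
  have hu1 : ∀ z, ‖dX ψ1 z‖ ≤ rm := by
    intro z
    obtain ⟨s, hs2, hs3, -⟩ := hψ1e z
    have := hdiff hs2 (hA0 _ z) hs3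
    have h2 := norm_add_le (dX ψ1 z - dX ψ z) (dX ψ z)
    rw [sub_add_cancel] at h2
    have h3 : (3 / 2 * N + d) * A true z ≤ (3 / 2 * N + 1) * a z := by
      have := hAa true z
      have := hA0 true z
      have := ha0 z
      gcongr; linarith
    have h4 := har z
    have h5 := hur z
    have h6 := mul_nonneg hN0 (norm_nonneg (dX ψ z))
    have h7 := mul_nonneg hN0 (ha0 z)
    have := ha0 z
    linarith
  obtain ⟨ψ2, hψ2, hψ2p, hψ2z, hψ2e⟩ := hwave ψ1 hψ1 hψ1p (fun z => (hu1 z).trans hrmw) (A false)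
    (hAs _) (hAp _) (hA0 _) (fun z => ((hAa _ z).trans (harm z)).trans hrmw) (hAt _)
    (θ false) (hθ _) (hθp _) (hθx _) η1 hη10
  refine ⟨ψ2, hψ2, hψ2p, fun z hz => ?_, fun z => ?_⟩
  · obtain ⟨x1, x2⟩ := hψ1z z (hAz _ z hz)
    obtain ⟨y1, y2⟩ := hψ2z z (hAz _ z hz)
    exact ⟨y1.trans x1, y2.trans x2⟩
  obtain ⟨se, se2, e1, e2⟩ := hψ1e z
  obtain ⟨so, so2, o1, o2⟩ := hψ2e z
  have e1' := hdiff se2 (hA0 _ z) e1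
  have o1' := hdiff so2 (hA0 _ z) o1
  have hη1le : 2 * η1 ≤ η := by nlinarith
  constructor
  · have : dX ψ2 z - dX ψ z = (dX ψ2 z - dX ψ1 z) + (dX ψ1 z - dX ψ z) := by abel
    rw [this]
    have h3 : (3 / 2 * N + d) * A true z ≤ (3 / 2 * N + 1 / 2) * a z := by
      have := hAa true z
      have := hA0 true z
      have := ha0 z
      gcongr
    have h4 : (3 / 2 * N + d) * A false z ≤ (3 / 2 * N + 1 / 2) * a z := by
      have := hAa false z
      have := hA0 false z
      have := ha0 z
      gcongr
    have := norm_add_le (dX ψ2 z - dX ψ1 z) (dX ψ1 z - dX ψ z)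
    linarith
  set ee := dT (θ true) z / dX (θ true) z + Λ (dX ψ z) with hee
  set eo := dT (θ false) z / dX (θ false) z + Λ (dX ψ1 z) with heo
  have kee : A true z * |ee| ≤ A true z * η1 := by
    by_cases hz : ζ true z.1 = 0
    · have : A true z = 0 := by simp only [hA, hz, zero_mul]
      simp [this]
    · exact mul_le_mul_of_nonneg_left (hθe true z hz) (hA0 _ z)
  have keo : A false z * |eo| ≤ A false z * (η1 + |Λ (dX ψ1 z) - Λ (dX ψ z)|) := by
    by_cases hz : ζ false z.1 = 0
    · have : A false z = 0 := by simp only [hA, hz, zero_mul]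
      simp [this]
    · refine mul_le_mul_of_nonneg_left ?_ (hA0 _ z)
      have h1 := hθe false z hz
      have : eo = (dT (θ false) z / dX (θ false) z + L z) + (Λ (dX ψ1 z) - Λ (dX ψ z)) := by
        rw [heo, hL]; ring
      rw [this]
      exact (abs_add_le _ _).trans (by linarith)
  have kdl : |Λ (dX ψ1 z) - Λ (dX ψ z)| ≤ A true z * |se| * |g| + d * C * A true z + C * η1 := by
    have h1 := hs' (dX ψ1 z) (hball (by rw [mem_ball_zero_iff]; linarith [hu1 z])).1
      (dX ψ z) (hball (by rw [mem_ball_zero_iff]; linarith [hurm z])).1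
    set w := dX ψ1 z - dX ψ z with hw
    have h2 : |DΛ w| ≤ A true z * |se| * |g| + ‖DΛ‖ * (d * A true z + η1) := by
      have : DΛ w = DΛ (w - (A true z * se) • r 0) + A true z * se * g := by
        rw [map_sub DΛ w, map_smul, smul_eq_mul, hg, cG]; ring
      rw [this]
      have t1 := DΛ.le_opNorm (w - (A true z * se) • r 0)
      have t2 : ‖DΛ‖ * ‖w - (A true z * se) • r 0‖ ≤ ‖DΛ‖ * (d * A true z + η1) := by gcongr
      have t3 : |A true z * se * g| = A true z * |se| * |g| := by
        rw [abs_mul, abs_mul, abs_of_nonneg (hA0 _ z)]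
      have := abs_add_le (DΛ (w - (A true z * se) • r 0)) (A true z * se * g)
      rw [Real.norm_eq_abs] at t1
      linarith
    have h3 : d * ‖w‖ ≤ d * (2 * N + 2) * A true z + (2 * N + 2) * η1 := by
      have hA := hA0 true z
      calc d * ‖w‖ ≤ d * ((3 / 2 * N + d) * A true z + η1) := by gcongr
        _ = d * (3 / 2 * N + d) * A true z + d * η1 := by ring
        _ ≤ d * (2 * N + 2) * A true z + (2 * N + 2) * η1 := by
          gcongr <;> linarith
    have h4 := abs_add_le (Λ (dX ψ1 z) - Λ (dX ψ z) - DΛ w) (DΛ w)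
    rw [sub_add_cancel] at h4
    rw [Real.norm_eq_abs] at h1
    rw [hC]
    nlinarith
  obtain ⟨k1, k2⟩ := step_arith (ha1' z) (ha0 z) (hA0 true z) (hA0 false z) (hA2 z) se2 so2 hd0.le
    (by linarith) hC1 hη10.le kee keo kdl
  refine ⟨_, k1.trans ?_, ?_⟩
  · have : 2 * |g| + d * C ≤ 2 * |g| + δ := by linarith
    have t : (2 * |g| + d * C) * a z ^ 2 ≤ (2 * |g| + δ) * a z ^ 2 := by gcongr
    nlinarith
  · have hid : Rr f ψ2 z - Rr f ψ z + (a z ^ 2 / 2) • cC f Λ r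
        + (A true z ^ 2 * se ^ 2 / 2 * g + ee * A true z * se
          + (A false z ^ 2 * so ^ 2 / 2 * g + eo * A false z * so)) • r 0
        = (Rr f ψ2 z - Rr f ψ1 z + (A false z ^ 2 / 2) • cC f Λ r
          + (A false z ^ 2 * so ^ 2 / 2 * g + eo * A false z * so) • r 0)
        + (Rr f ψ1 z - Rr f ψ z + (A true z ^ 2 / 2) • cC f Λ r
          + (A true z ^ 2 * se ^ 2 / 2 * g + ee * A true z * se) • r 0) := by
      rw [← hA2 z]; module
    rw [hid]
    have t : d * (1 + |g| + C) * a z ^ 2 ≤ δ * a z ^ 2 := by gcongr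
    refine (norm_add_le _ _).trans ((add_le_add o2 e2).trans ?_)
    nlinarith
end core


section core
open scoped ContDiff Topology
variable {E : Type*} [NormedAddCommGroup E] [NormedSpace ℝ E]

/-- The pair of families together with the dual coordinates of the defect. -/
structure TwoFam (V : Set E) (f : E → E) (Λp : E → ℝ) (rp : E → E) (Λm : E → ℝ) (rm : E → E)
    (P Q : E →L[ℝ] ℝ) : Prop where
  fp : Fam V f Λp rp
  fm : Fam V f Λm rm
  Pp : P (cC f Λp rp) = 1
  Qp : Q (cC f Λp rp) = 0
  Pm : P (cC f Λm rm) = 0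
  Qm : Q (cC f Λm rm) = 1
  Prp : P (rp 0) = 0
  Qrm : Q (rm 0) = 0
  Qg : |Q (rp 0)| * |cG Λp rp| ≤ 1 / 512
  Pg : |P (rm 0)| * |cG Λm rm| ≤ 1 / 512

/-- Subsolution with defect comparable to `ρ`. -/
structure St (f : E → E) (P Q : E →L[ℝ] ℝ) (ψ : ℝ × ℝ → E) (ρ : ℝ → ℝ) (N ϑ R : ℝ) : Prop where
  cd : ContDiff ℝ ∞ ψ
  per : Per ψ
  cdr : ContDiff ℝ ∞ ρ
  rho0 : ∀ t, 0 ≤ ρ t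
  rhoN : ∀ t, ρ t ≤ N ^ 2
  rhot : ∀ t, 1 ≤ |t| → ρ t = 0
  ut : ∀ t x, 1 ≤ |t| → dX ψ (t, x) = 0
  hP : ∀ z, |P (Rr f ψ z) - ρ z.1| ≤ ϑ * ρ z.1
  hQ : ∀ z, |Q (Rr f ψ z) - ρ z.1| ≤ ϑ * ρ z.1
  hR : ∀ z, ‖dX ψ z‖ ≤ R

/-- time cutoff -/
def cut (N y : ℝ) : ℝ := Real.smoothTransition (8 * y / N ^ 2 - 1)

theorem cut_cd (N : ℝ) : ContDiff ℝ ∞ (cut N) := by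
  unfold cut
  exact smoothTransition_cd.comp (by fun_prop)

theorem amp {p : ℝ × ℝ → ℝ} {ρ : ℝ → ℝ} {N ϑ : ℝ} (hN : 0 < N) (hϑ : ϑ < 1 / 4)
    (hp : ContDiff ℝ ∞ p) (hpp : Per p) (hρ : ContDiff ℝ ∞ ρ) (hρ0 : ∀ t, 0 ≤ ρ t)
    (hpr : ∀ z, |p z - ρ z.1| ≤ ϑ * ρ z.1) :
    ∃ a : ℝ × ℝ → ℝ, ContDiff ℝ ∞ a ∧ Per a ∧ (∀ z, 0 ≤ a z) ∧
      (∀ z, a z ^ 2 = 2 * cut N (ρ z.1) ^ 2 * (p z - ρ z.1 / 4)) := by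
  set om : ℝ → ℝ := fun y => Real.smoothTransition (1 - 8 * y / N ^ 2) with hom
  have homs : ContDiff ℝ ∞ om := smoothTransition_cd.comp (by fun_prop)
  set m : ℝ × ℝ → ℝ := fun z => 2 * (p z - ρ z.1 / 4) + om (ρ z.1) with hm
  have hρ1 : ContDiff ℝ ∞ (fun z : ℝ × ℝ => ρ z.1) := hρ.comp contDiff_fst
  have hms : ContDiff ℝ ∞ m :=
    (contDiff_const.mul (hp.sub (hρ1.div_const 4))).add (homs.comp hρ1)
  have hp0 : ∀ z, ρ z.1 / 2 ≤ p z - ρ z.1 / 4 := fun z => by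
    have := (abs_le.1 (hpr z)).1
    nlinarith [hρ0 z.1]
  have hm0 : ∀ z, 0 < m z := by
    intro z
    have h1 := hp0 z
    have h2 := hρ0 z.1
    have h3 : 0 ≤ om (ρ z.1) := Real.smoothTransition.nonneg _
    rcases eq_or_lt_of_le h2 with h | h
    · have : 0 < om (ρ z.1) := Real.smoothTransition.pos_of_pos (by rw [← h]; norm_num)
      simp only [hm]; linarith
    · simp only [hm]; linarith
  refine ⟨fun z => cut N (ρ z.1) * √(m z), ((cut_cd N).comp hρ1).mul
    (hms.sqrt (fun z => (hm0 z).ne')), ?_, ?_, ?_⟩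
  · intro t x
    simp only [hm, hpp t x]
  · exact fun z => mul_nonneg (Real.smoothTransition.nonneg _) (Real.sqrt_nonneg _)
  · intro z
    rw [mul_pow, Real.sq_sqrt (hm0 z).le]
    by_cases hc : cut N (ρ z.1) = 0
    · rw [hc]; ring
    · have h1 : 0 < 8 * ρ z.1 / N ^ 2 - 1 := by
        by_contra h
        exact hc (Real.smoothTransition.zero_of_nonpos (not_lt.1 h))
      have : om (ρ z.1) = 0 := Real.smoothTransition.zero_of_nonpos (by linarith)
      simp only [hm, this]; ring

/-- effect of one family step on a linear functional -/
theorem func_step {T : E →L[ℝ] ℝ} {x c r0 : E} {a γ g δ η : ℝ}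
    (hγ : |γ| ≤ (2 * |g| + δ) * a ^ 2 + η) (hx : ‖x + (a ^ 2 / 2) • c + γ • r0‖ ≤ δ * a ^ 2 + η)
    (hg : |T r0| * |g| ≤ 1 / 512) :
    |T x + a ^ 2 / 2 * T c| ≤ (1 / 256 + (‖T‖ + |T r0|) * δ) * a ^ 2 + (‖T‖ + |T r0|) * η := by
  have h1 := T.le_opNorm (x + (a ^ 2 / 2) • c + γ • r0)
  rw [map_add, map_add, map_smul, map_smul, smul_eq_mul, smul_eq_mul, Real.norm_eq_abs] at h1
  have h2 : ‖T‖ * ‖x + (a ^ 2 / 2) • c + γ • r0‖ ≤ ‖T‖ * (δ * a ^ 2 + η) := by gcongr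
  have h3 : |γ * T r0| ≤ ((2 * |g| + δ) * a ^ 2 + η) * |T r0| := by
    rw [abs_mul]; gcongr
  have h4 := abs_sub (T x + a ^ 2 / 2 * T c + γ * T r0) (γ * T r0)
  rw [add_sub_cancel_right] at h4
  have h5 : 2 * (|T r0| * |g|) * a ^ 2 ≤ 2 * (1 / 512) * a ^ 2 := by gcongr
  nlinarith

theorem stage_arith {p p2 ρ c ϑ B C : ℝ} (hρ : 0 ≤ ρ) (hc0 : 0 ≤ c) (hc1 : c ≤ 1)
    (hϑ : 1 / 8 ≤ ϑ) (hϑ2 : ϑ < 1 / 4) (hp : |p - ρ| ≤ ϑ * ρ)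
    (hB : B ≤ c ^ 2 * ρ / 32 + C) (hC : C ≤ (1 / 4 - ϑ) / 8 * ρ)
    (h : |p2 - p + c ^ 2 * (p - ρ / 4)| ≤ B) :
    |p2 - (1 - 3 / 4 * c ^ 2) * ρ| ≤ (ϑ + 1 / 4) / 2 * ((1 - 3 / 4 * c ^ 2) * ρ) := by
  have hc2 : c ^ 2 ≤ 1 := by nlinarith
  have hc3 : 0 ≤ c ^ 2 := by positivity
  generalize c ^ 2 = χ at *
  have h1 : p2 - (1 - 3 / 4 * χ) * ρ = (p2 - p + χ * (p - ρ / 4)) + (1 - χ) * (p - ρ) := by ring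
  have h2 : |(1 - χ) * (p - ρ)| ≤ (1 - χ) * (ϑ * ρ) := by
    rw [abs_mul, abs_of_nonneg (by linarith)]
    exact mul_le_mul_of_nonneg_left hp (by linarith)
  rw [h1]
  refine (abs_add_le _ _).trans ((add_le_add h h2).trans ?_)
  have e1 : 0 ≤ (ϑ - 1 / 8) * (χ * ρ) := mul_nonneg (by linarith) (by positivity)
  have e2 : 0 ≤ (1 / 4 - ϑ) * ((1 - χ) * ρ) :=
    mul_nonneg (by linarith) (mul_nonneg (by linarith) hρ)
  nlinarith

set_option maxHeartbeats 2000000 in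
theorem TwoFam.stage {V : Set E} {f : E → E} {Λp : E → ℝ} {rp : E → E} {Λm : E → ℝ} {rm : E → E}
    {P Q : E →L[ℝ] ℝ} (H : TwoFam V f Λp rp Λm rm P Q) :
    ∃ r1 > 0, ∃ K > 0, (∀ v : E, ‖v‖ ≤ r1 → v ∈ V) ∧
      ∀ (N ϑ R : ℝ) (ψ : ℝ × ℝ → E) (ρ : ℝ → ℝ), 0 < N → 1 / 8 ≤ ϑ → ϑ < 1 / 4 → R + K * N ≤ r1 →
        St f P Q ψ ρ N ϑ R → ∃ (ψ' : ℝ × ℝ → E) (ρ' : ℝ → ℝ),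
          St f P Q ψ' ρ' (N / 2) ((ϑ + 1 / 4) / 2) (R + K * N) ∧
          (∀ z, ‖dX ψ' z - dX ψ z‖ ≤ K * N) ∧ (∀ t x, 1 ≤ |t| → ψ' (t, x) = ψ (t, x)) := by
  have hV : V ∈ 𝓝 (0 : E) := H.fp.isOpen.mem_nhds H.fp.zero_mem
  set C : ℝ := ‖P‖ + ‖Q‖ + |P (rm 0)| + |Q (rp 0)| + 1 with hC
  have hPn := norm_nonneg P
  have hQn := norm_nonneg Q
  have hPa := abs_nonneg (P (rm 0))
  have hQa := abs_nonneg (Q (rp 0))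
  have hC0 : 0 < C := by positivity
  set δ : ℝ := 1 / (256 * C) with hδ
  have hδ0 : 0 < δ := by positivity
  have hδC : C * δ = 1 / 256 := by rw [hδ]; field_simp
  obtain ⟨ra, hra, stepP⟩ := H.fp.step hδ0
  obtain ⟨rb, hrb, stepM⟩ := H.fm.step hδ0
  obtain ⟨rc, hrc, hball⟩ := Metric.mem_nhds_iff.1 hV
  set Kp := 3 * ‖rp 0‖ + 1 with hKp
  set Km := 3 * ‖rm 0‖ + 1 with hKm
  have hKp1 : 1 ≤ Kp := by have := norm_nonneg (rp 0); linarith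
  have hKm1 : 1 ≤ Km := by have := norm_nonneg (rm 0); linarith
  refine ⟨min (min ra rb) (rc / 2), by positivity, 2 * (Kp + Km), by positivity, ?_, ?_⟩
  · intro v hv
    have : ‖v‖ ≤ rc / 2 := hv.trans (min_le_right _ _)
    exact hball (by rw [mem_ball_zero_iff]; linarith)
  intro N ϑ R ψ ρ hN hϑ hϑ2 hRK S
  have hRa : R + 2 * (Kp + Km) * N ≤ ra := hRK.trans ((min_le_left _ _).trans (min_le_left _ _))
  have hRb : R + 2 * (Kp + Km) * N ≤ rb := hRK.trans ((min_le_left _ _).trans (min_le_right _ _))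
  have hRc : R + 2 * (Kp + Km) * N ≤ rc / 2 := hRK.trans (min_le_right _ _)
  have hKpN : N ≤ Kp * N := by nlinarith
  have hKmN : N ≤ Km * N := by nlinarith
  have hR0 : 0 ≤ R := (norm_nonneg _).trans (S.hR (0, 0))
  have huV : ∀ z, dX ψ z ∈ V := fun z => hball (by
    rw [mem_ball_zero_iff]
    have := S.hR z
    nlinarith)
  have hRs : ContDiff ℝ ∞ (Rr f ψ) :=
    (contDiff_dT S.cd).neg.sub (H.fp.hf.comp_contDiff (contDiff_dX S.cd) huV)
  have hRp : Per (Rr f ψ) := fun t x => by simp only [Rr, S.per.dX t x, S.per.dT t x]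
  obtain ⟨a, has, hap, ha0, ha2⟩ := amp (p := fun z => P (Rr f ψ z)) hN hϑ2
    (P.contDiff.comp hRs) (fun t x => by simp only [hRp t x]) S.cdr S.rho0 S.hP
  obtain ⟨b, hbs, hbp, hb0, hb2⟩ := amp (p := fun z => Q (Rr f ψ z)) hN hϑ2
    (Q.contDiff.comp hRs) (fun t x => by simp only [hRp t x]) S.cdr S.rho0 S.hQ
  set c : ℝ → ℝ := fun t => cut N (ρ t) with hc
  have hcs : ContDiff ℝ ∞ c := (cut_cd N).comp S.cdr
  have hc0 : ∀ t, 0 ≤ c t := fun t => Real.smoothTransition.nonneg _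
  have hc1 : ∀ t, c t ≤ 1 := fun t => Real.smoothTransition.le_one _
  have hN2 : 0 < N ^ 2 := by positivity
  have hcz : ∀ t, ρ t ≤ N ^ 2 / 8 → c t = 0 := fun t ht =>
    Real.smoothTransition.zero_of_nonpos (by
      have : 8 * ρ t / N ^ 2 ≤ 1 := by rw [div_le_one hN2]; linarith
      linarith)
  have hco : ∀ t, N ^ 2 / 4 ≤ ρ t → c t = 1 := fun t ht =>
    Real.smoothTransition.one_of_one_le (by
      have : 2 ≤ 8 * ρ t / N ^ 2 := by rw [le_div_iff₀ hN2]; linarith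
      linarith)
  have ha2' : ∀ z, a z ^ 2 ≤ 2 * c z.1 ^ 2 * ρ z.1 := fun z => by
    rw [ha2 z]
    have := (abs_le.1 (S.hP z)).2
    have h0 := S.rho0 z.1
    have : P (Rr f ψ z) - ρ z.1 / 4 ≤ ρ z.1 := by nlinarith
    gcongr
  have hb2' : ∀ z, b z ^ 2 ≤ 2 * c z.1 ^ 2 * ρ z.1 := fun z => by
    rw [hb2 z]
    have := (abs_le.1 (S.hQ z)).2
    have h0 := S.rho0 z.1
    have : Q (Rr f ψ z) - ρ z.1 / 4 ≤ ρ z.1 := by nlinarith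
    gcongr
  have hcr : ∀ t, 2 * c t ^ 2 * ρ t ≤ 2 * N ^ 2 := fun t => by
    have h1 : c t ^ 2 ≤ 1 := pow_le_one₀ (hc0 t) (hc1 t)
    have := S.rhoN t
    have := S.rho0 t
    nlinarith
  have haN : ∀ z, a z ≤ 3 / 2 * N := fun z =>
    abs_le_of_sq_le_sq' (by nlinarith [ha2' z, hcr z.1]) (by positivity) |>.2
  have hbN : ∀ z, b z ≤ 3 / 2 * N := fun z =>
    abs_le_of_sq_le_sq' (by nlinarith [hb2' z, hcr z.1]) (by positivity) |>.2
  have haz : ∀ z : ℝ × ℝ, ρ z.1 ≤ N ^ 2 / 8 → a z = 0 := fun z hz => by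
    have := ha2' z
    rw [hcz z.1 hz] at this
    have h2 : a z ^ 2 ≤ 0 := by simpa using this
    exact pow_eq_zero_iff (two_ne_zero) |>.1 (le_antisymm h2 (sq_nonneg _))
  have hbz : ∀ z : ℝ × ℝ, ρ z.1 ≤ N ^ 2 / 8 → b z = 0 := fun z hz => by
    have := hb2' z
    rw [hcz z.1 hz] at this
    have h2 : b z ^ 2 ≤ 0 := by simpa using this
    exact pow_eq_zero_iff (two_ne_zero) |>.1 (le_antisymm h2 (sq_nonneg _))
  have hρt : ∀ t, 1 ≤ |t| → ρ t ≤ N ^ 2 / 8 := fun t ht => by rw [S.rhot t ht]; positivity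
  -- error tolerance
  set η : ℝ := min (N / 2) ((1 / 4 - ϑ) / 8 * (N ^ 2 / 8) / (2 * C)) with hη
  have hη0 : 0 < η := by
    have : 0 < 1 / 4 - ϑ := by linarith
    positivity
  have hηN : η ≤ N / 2 := min_le_left _ _
  have hηC : 2 * C * η ≤ (1 / 4 - ϑ) / 8 * (N ^ 2 / 8) := by
    have : η ≤ (1 / 4 - ϑ) / 8 * (N ^ 2 / 8) / (2 * C) := min_le_right _ _
    rw [le_div_iff₀ (by positivity)] at this; linarith
  obtain ⟨ψ1, hψ1, hψ1p, hψ1z, hψ1e⟩ := stepP ψ S.cd S.per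
    (fun z => (S.hR z).trans (by nlinarith)) S.ut a has hap ha0
    (fun z => (haN z).trans (by linarith)) (fun t x ht => haz (t, x) (hρt t ht)) η hη0
  have d1 : ∀ z, ‖dX ψ1 z - dX ψ z‖ ≤ 3 / 2 * (Kp * N) + N / 2 := fun z => by
    refine (hψ1e z).1.trans ?_
    have : Kp * a z ≤ Kp * (3 / 2 * N) := by have := haN z; gcongr
    linarith
  have hψ1t : ∀ t x, 1 ≤ |t| → dX ψ1 (t, x) = 0 := fun t x ht => by
    rw [dX, (hψ1z _ (haz (t, x) (hρt t ht))).2]; exact S.ut t x ht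
  obtain ⟨ψ2, hψ2, hψ2p, hψ2z, hψ2e⟩ := stepM ψ1 hψ1 hψ1p
    (fun z => by
      have := norm_add_le (dX ψ1 z - dX ψ z) (dX ψ z)
      rw [sub_add_cancel] at this
      linarith [d1 z, S.hR z]) hψ1t b hbs hbp hb0
    (fun z => (hbN z).trans (by linarith)) (fun t x ht => hbz (t, x) (hρt t ht)) η hη0
  have d2 : ∀ z, ‖dX ψ2 z - dX ψ1 z‖ ≤ 3 / 2 * (Km * N) + N / 2 := fun z => by
    refine (hψ2e z).1.trans ?_
    have : Km * b z ≤ Km * (3 / 2 * N) := by have := hbN z; gcongr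
    linarith
  have d3 : ∀ z, ‖dX ψ2 z - dX ψ z‖ ≤ 2 * (Kp + Km) * N := fun z => by
    have : dX ψ2 z - dX ψ z = (dX ψ2 z - dX ψ1 z) + (dX ψ1 z - dX ψ z) := by abel
    rw [this]
    refine (norm_add_le _ _).trans ((add_le_add (d2 z) (d1 z)).trans ?_)
    linarith
  have same : ∀ z : ℝ × ℝ, ρ z.1 ≤ N ^ 2 / 8 → ψ2 z = ψ z ∧ fderiv ℝ ψ2 z = fderiv ℝ ψ z := by
    intro z hz
    obtain ⟨x1, x2⟩ := hψ1z z (haz z hz)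
    obtain ⟨y1, y2⟩ := hψ2z z (hbz z hz)
    exact ⟨y1.trans x1, y2.trans x2⟩
  -- functional estimate
  have main : ∀ z : ℝ × ℝ,
      |P (Rr f ψ2 z) - P (Rr f ψ z) + c z.1 ^ 2 * (P (Rr f ψ z) - ρ z.1 / 4)|
        ≤ c z.1 ^ 2 * ρ z.1 / 32 + 2 * C * η ∧
      |Q (Rr f ψ2 z) - Q (Rr f ψ z) + c z.1 ^ 2 * (Q (Rr f ψ z) - ρ z.1 / 4)|
        ≤ c z.1 ^ 2 * ρ z.1 / 32 + 2 * C * η := by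
    intro z
    obtain ⟨-, γ1, g1, e1⟩ := hψ1e z
    obtain ⟨-, γ2, g2, e2⟩ := hψ2e z
    have A1 := func_step (T := P) g1 e1 (by rw [H.Prp]; norm_num)
    have A2 := func_step (T := P) g2 e2 H.Pg
    have B1 := func_step (T := Q) g1 e1 H.Qg
    have B2 := func_step (T := Q) g2 e2 (by rw [H.Qrm]; norm_num)
    rw [H.Pp, mul_one, map_sub, H.Prp, abs_zero, add_zero] at A1
    rw [H.Pm, mul_zero, add_zero, map_sub] at A2
    rw [H.Qp, mul_zero, add_zero, map_sub] at B1
    rw [H.Qm, mul_one, map_sub, H.Qrm, abs_zero, add_zero] at B2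
    have bnd : ∀ (c' y : ℝ), c' ≤ C → 0 ≤ y →
        (1 / 256 + c' * δ) * y + c' * η ≤ 1 / 128 * y + C * η := by
      intro c' y hc' hy
      have : (1 / 256 + c' * δ) ≤ 1 / 128 := by
        have : c' * δ ≤ C * δ := by gcongr
        linarith
      gcongr
    have A1' := A1.trans (bnd _ _ (by linarith) (sq_nonneg _))
    have A2' := A2.trans (bnd _ _ (by linarith) (sq_nonneg _))
    have B1' := B1.trans (bnd _ _ (by linarith) (sq_nonneg _))
    have B2' := B2.trans (bnd _ _ (by linarith) (sq_nonneg _))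
    have q1 := ha2' z
    have q2 := hb2' z
    constructor
    · have : P (Rr f ψ2 z) - P (Rr f ψ z) + c z.1 ^ 2 * (P (Rr f ψ z) - ρ z.1 / 4)
          = (P (Rr f ψ2 z) - P (Rr f ψ1 z)) + (P (Rr f ψ1 z) - P (Rr f ψ z) + a z ^ 2 / 2) := by
        rw [ha2 z]; ring
      rw [this]
      refine (abs_add_le _ _).trans ((add_le_add A2' A1').trans ?_)
      linarith
    · have : Q (Rr f ψ2 z) - Q (Rr f ψ z) + c z.1 ^ 2 * (Q (Rr f ψ z) - ρ z.1 / 4)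
          = (Q (Rr f ψ2 z) - Q (Rr f ψ1 z) + b z ^ 2 / 2) + (Q (Rr f ψ1 z) - Q (Rr f ψ z)) := by
        rw [hb2 z]; ring
      rw [this]
      refine (abs_add_le _ _).trans ((add_le_add B2' B1').trans ?_)
      linarith
  have Rsame : ∀ z : ℝ × ℝ, ρ z.1 ≤ N ^ 2 / 8 → Rr f ψ2 z = Rr f ψ z := fun z hz => by
    simp only [Rr, dT, dX, (same z hz).2]
  have fin : ∀ (T : E →L[ℝ] ℝ), (∀ z, |T (Rr f ψ z) - ρ z.1| ≤ ϑ * ρ z.1) →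
      (∀ z : ℝ × ℝ, |T (Rr f ψ2 z) - T (Rr f ψ z) + c z.1 ^ 2 * (T (Rr f ψ z) - ρ z.1 / 4)|
        ≤ c z.1 ^ 2 * ρ z.1 / 32 + 2 * C * η) →
      ∀ z : ℝ × ℝ, |T (Rr f ψ2 z) - (1 - 3 / 4 * c z.1 ^ 2) * ρ z.1|
        ≤ (ϑ + 1 / 4) / 2 * ((1 - 3 / 4 * c z.1 ^ 2) * ρ z.1) := by
    intro T h1 h2 z
    by_cases hz : ρ z.1 ≤ N ^ 2 / 8
    · rw [Rsame z hz, hcz z.1 hz]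
      have := h1 z
      have h0 := S.rho0 z.1
      simp only [ne_eq, OfNat.ofNat_ne_zero, not_false_eq_true, zero_pow, mul_zero, sub_zero, one_mul]
      nlinarith
    · refine stage_arith (S.rho0 z.1) (hc0 z.1) (hc1 z.1) hϑ hϑ2 (h1 z) le_rfl ?_ (h2 z)
      refine hηC.trans ?_
      have : 0 < 1 / 4 - ϑ := by linarith
      have := (not_le.1 hz).le
      gcongr
  refine ⟨ψ2, fun t => (1 - 3 / 4 * c t ^ 2) * ρ t, ?_, d3, fun t x ht => (same (t, x) (hρt t ht)).1⟩
  have hc2 : ∀ t, c t ^ 2 ≤ 1 := fun t => pow_le_one₀ (hc0 t) (hc1 t)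
  refine ⟨hψ2, hψ2p, (contDiff_const.sub (contDiff_const.mul (hcs.pow 2))).mul S.cdr, ?_, ?_, ?_, ?_,
    fin P S.hP (fun z => (main z).1), fin Q S.hQ (fun z => (main z).2), ?_⟩
  · exact fun t => mul_nonneg (by linarith [hc2 t]) (S.rho0 t)
  · intro t
    by_cases ht : N ^ 2 / 4 ≤ ρ t
    · simp only [hco t ht]
      linarith [S.rhoN t]
    · have := S.rho0 t
      have h3 : 0 ≤ c t ^ 2 := sq_nonneg _
      nlinarith
  · intro t ht
    simp only [S.rhot t ht, mul_zero]
  · intro t x ht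
    rw [dX, (same (t, x) (hρt t ht)).2]; exact S.ut t x ht
  · intro z
    have := norm_add_le (dX ψ2 z - dX ψ z) (dX ψ z)
    rw [sub_add_cancel] at this
    linarith [d3 z, S.hR z]
end core


section core
open scoped ContDiff Topology
variable {E : Type*} [NormedAddCommGroup E] [NormedSpace ℝ E]

theorem ramp : ∃ (s : ℝ → ℝ) (B : ℝ), 0 < B ∧ ContDiff ℝ ∞ s ∧ ContDiff ℝ ∞ (deriv s) ∧
    (∀ t, 0 ≤ deriv s t) ∧ (∀ t, deriv s t ≤ B) ∧ (∀ t, 1 ≤ |t| → deriv s t = 0) ∧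
    s (-1) = 0 ∧ s 1 = 1 := by
  set s : ℝ → ℝ := fun t => Real.smoothTransition ((t + 1) / 2) with hs
  have hsc : ContDiff ℝ ∞ s := smoothTransition_cd.comp (by fun_prop)
  have hd : ContDiff ℝ ∞ (deriv s) := (contDiff_infty_iff_deriv.1 hsc).2
  have hmono : Monotone s := fun x y hxy => Real.smoothTransition.monotone (by linarith)
  have h0 : ∀ t, t ≤ -1 → s t = 0 := fun t ht => Real.smoothTransition.zero_of_nonpos (by linarith)
  have h1 : ∀ t, 1 ≤ t → s t = 1 := fun t ht => Real.smoothTransition.one_of_one_le (by linarith)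
  have hz : ∀ t, 1 ≤ |t| → deriv s t = 0 := by
    intro t ht
    rcases le_abs.1 ht with h | h
    · apply IsLocalMax.deriv_eq_zero
      filter_upwards with y
      rw [h1 t h]; exact Real.smoothTransition.le_one _
    · apply IsLocalMin.deriv_eq_zero
      filter_upwards with y
      rw [h0 t (by linarith)]; exact Real.smoothTransition.nonneg _
  obtain ⟨B, hB⟩ := (isCompact_Icc (a := (-1:ℝ)) (b := 1)).exists_bound_of_continuousOn
    hd.continuous.continuousOn
  refine ⟨s, max B 1, by positivity, hsc, hd, fun t => hmono.deriv_nonneg, ?_, hz, h0 _ le_rfl, h1 _ le_rfl⟩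
  intro t
  by_cases ht : |t| ≤ 1
  · exact (le_abs_self _).trans ((hB t (abs_le.1 ht)).trans (le_max_left _ _))
  · rw [hz t (not_le.1 ht).le]; positivity

theorem start {f : E → E} {P Q : E →L[ℝ] ℝ} {e : E} (hP : P e = 1) (hQ : Q e = 1) {N : ℝ} (hN : 0 < N) :
    ∃ (ψ : ℝ × ℝ → E) (ρ : ℝ → ℝ) (m : ℝ), 0 < m ∧ St f P Q ψ ρ N (1 / 8) 0 ∧
      ψ (1, 0) = - f 0 - m • e ∧ ψ (-1, 0) = f 0 := by
  obtain ⟨s, B, hB, hs, hds, h0, hb, hz, hm1, hp1⟩ := ramp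
  set m : ℝ := N ^ 2 / B with hm
  have hm0 : 0 < m := by positivity
  set ψ : ℝ × ℝ → E := fun z => -(z.1 • f 0) - (m * s z.1) • e with hψ
  have hψs : ContDiff ℝ ∞ ψ :=
    (contDiff_fst.smul contDiff_const).neg.sub
      ((contDiff_const.mul (hs.comp contDiff_fst)).smul contDiff_const)
  have hfd : ∀ z v, fderiv ℝ ψ z v = -(v.1 • f 0) - (m * (deriv s z.1 * v.1)) • e := by
    intro z v
    have e1 := hasFDerivAt_fst (𝕜 := ℝ) (E := ℝ) (F := ℝ) (p := z)
    have e2 := (hs.differentiable (by simp) z.1).hasDerivAt.comp_hasFDerivAt z e1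
    have e3 := (e1.smul_const (f 0)).neg.sub ((e2.const_mul m).smul_const e)
    have e4 : HasFDerivAt ψ _ z := e3
    rw [e4.fderiv]
    simp
  have hX : ∀ z, dX ψ z = 0 := fun z => by rw [dX, hfd]; simp
  have hR : ∀ z, Rr f ψ z = (m * deriv s z.1) • e := fun z => by
    rw [Rr, hX, dT, hfd]; simp
  refine ⟨ψ, fun t => m * deriv s t, m, hm0, ⟨hψs, fun t x => rfl, contDiff_const.mul hds,
    fun t => mul_nonneg hm0.le (h0 t), ?_, ?_, fun t x _ => hX _, ?_, ?_, fun z => by rw [hX]; simp⟩, ?_, ?_⟩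
  · intro t
    calc m * deriv s t ≤ m * B := by have := hb t; gcongr
      _ = N ^ 2 := by rw [hm]; field_simp
  · intro t ht
    simp only [hz t ht, mul_zero]
  · intro z
    rw [hR, map_smul, hP]
    simpa using mul_nonneg hm0.le (h0 z.1)
  · intro z
    rw [hR, map_smul, hQ]
    simpa using mul_nonneg hm0.le (h0 z.1)
  · simp [hψ, hp1]
  · simp [hψ, hm1]

set_option maxHeartbeats 1000000 in
theorem TwoFam.iterate [CompleteSpace E] {V : Set E} {f : E → E} {Λp : E → ℝ} {rp : E → E}
    {Λm : E → ℝ} {rm : E → E} {P Q : E →L[ℝ] ℝ} (H : TwoFam V f Λp rp Λm rm P Q)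
    {C : ℝ} (hC : 0 < C) (hPQ : ∀ v, ‖v‖ ≤ C * (|P v| + |Q v|)) :
    ∃ (ψ : ℕ → ℝ × ℝ → E) (u : ℝ × ℝ → E), (∀ q, ContDiff ℝ ∞ (ψ q)) ∧ (∀ q, Per (ψ q)) ∧
      TendstoUniformly (fun q => dX (ψ q)) u Filter.atTop ∧
      TendstoUniformly (fun q z => - dT (ψ q) z) (fun z => f (u z)) Filter.atTop ∧
      (∀ z, u z ∈ V) ∧ (∀ t x, 1 ≤ |t| → u (t, x) = 0) ∧ ∃ z, u z ≠ 0 := by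
  have hV : V ∈ 𝓝 (0 : E) := H.fp.isOpen.mem_nhds H.fp.zero_mem
  obtain ⟨r1, hr1, K, hK, hrV, hstage⟩ := H.stage
  obtain ⟨Kf, sL, hsL, hLip⟩ :=
    ((H.fp.hf.contDiffAt hV).hasStrictFDerivAt (by simp)).exists_lipschitzOnWith
  obtain ⟨ρL, hρL, hball⟩ := Metric.mem_nhds_iff.1 hsL
  set N : ℝ := min r1 (ρL / 2) / (2 * K) with hN
  have hN0 : 0 < N := by positivity
  have h2KN : 2 * K * N = min r1 (ρL / 2) := by rw [hN]; field_simp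
  have hKr : 2 * K * N ≤ r1 := h2KN ▸ min_le_left _ _
  have hKL : 2 * K * N ≤ ρL / 2 := h2KN ▸ min_le_right _ _
  set e := cC f Λp rp + cC f Λm rm with he
  have hPe : P e = 1 := by rw [he, map_add, H.Pp, H.Pm, add_zero]
  have hQe : Q e = 1 := by rw [he, map_add, H.Qp, H.Qm, zero_add]
  obtain ⟨ψ0, ρ0, m, hm, hS0, hψp, hψm⟩ := start (f := f) hPe hQe hN0
  set Good : ℕ → (ℝ × ℝ → E) × (ℝ → ℝ) → Prop := fun q x => ∃ ϑ, 1 / 8 ≤ ϑ ∧ ϑ < 1 / 4 ∧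
    St f P Q x.1 x.2 (N / 2 ^ q) ϑ (2 * K * N * (1 - 1 / 2 ^ q)) with hGood
  have hstep : ∀ (q : ℕ) (x : {x // Good q x}), ∃ y : {y // Good (q + 1) y},
      (∀ z, ‖dX y.1.1 z - dX x.1.1 z‖ ≤ K * (N / 2 ^ q)) ∧
      (∀ t s, 1 ≤ |t| → y.1.1 (t, s) = x.1.1 (t, s)) := by
    rintro q ⟨x, ϑ, h1, h2, hS⟩
    have h2q : (0:ℝ) < 2 ^ q := by positivity
    have hRe : 2 * K * N * (1 - 1 / 2 ^ q) + K * (N / 2 ^ q) = 2 * K * N * (1 - 1 / 2 ^ (q + 1)) := by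
      rw [pow_succ]; field_simp; ring
    obtain ⟨ψ', ρ', hS', hd, hs⟩ := hstage _ _ _ _ _ (by positivity) h1 h2 (by
      rw [hRe]
      refine le_trans ?_ hKr
      have : (0:ℝ) < 1 / 2 ^ (q + 1) := by positivity
      have h3 : 0 < 2 * K * N := by positivity
      nlinarith) hS
    refine ⟨⟨(ψ', ρ'), (ϑ + 1 / 4) / 2, by linarith, by linarith, ?_⟩, hd, hs⟩
    rw [← hRe, pow_succ, ← div_div]
    exact hS'
  choose F hF1 hF2 using hstep
  set sq : (q : ℕ) → {x // Good q x} := fun q => Nat.rec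
    ⟨(ψ0, ρ0), 1 / 8, le_rfl, by norm_num, by simpa using hS0⟩ (fun q x => F q x) q with hsq
  have hsq0 : (sq 0).1 = (ψ0, ρ0) := rfl
  have hsqs : ∀ q, sq (q + 1) = F q (sq q) := fun q => rfl
  set ψ : ℕ → ℝ × ℝ → E := fun q => (sq q).1.1 with hψ
  have hd : ∀ q z, dist (dX (ψ q) z) (dX (ψ (q + 1)) z) ≤ (2 * K * N) / 2 / 2 ^ q := by
    intro q z
    rw [dist_comm, dist_eq_norm]
    have := hF1 q (sq q) z
    rw [← hsqs q] at this
    refine this.trans (le_of_eq ?_)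
    ring
  have hlim : ∀ z, ∃ v, Filter.Tendsto (fun q => dX (ψ q) z) Filter.atTop (𝓝 v) := fun z =>
    cauchySeq_tendsto_of_complete (cauchySeq_of_le_geometric_two (fun q => hd q z))
  choose u hu using hlim
  have hdu : ∀ q z, dist (dX (ψ q) z) (u z) ≤ (2 * K * N) / 2 ^ q := fun q z =>
    dist_le_of_le_geometric_two_of_tendsto (fun q => hd q z) (hu z) q
  have hub : ∀ q z, ‖dX (ψ q) z‖ ≤ 2 * K * N := by
    intro q z
    obtain ⟨ϑ, h1, h2, hS⟩ := (sq q).2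
    refine (hS.hR z).trans ?_
    have : (0:ℝ) < 1 / 2 ^ q := by positivity
    have h3 : 0 < 2 * K * N := by positivity
    nlinarith
  have hub' : ∀ z, ‖u z‖ ≤ 2 * K * N := fun z => le_of_tendsto (hu z).norm (Filter.Eventually.of_forall fun q => hub q z)
  have hmem : ∀ v : E, ‖v‖ ≤ 2 * K * N → v ∈ sL := fun v hv =>
    hball (by rw [mem_ball_zero_iff]; linarith)
  set C' : ℝ := 4 * C * N ^ 2 + Kf * (2 * K * N) with hC'
  have hdF : ∀ q z, dist (- dT (ψ q) z) (f (u z)) ≤ C' / 2 ^ q := by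
    intro q z
    obtain ⟨ϑ, h1, h2, hS⟩ := (sq q).2
    have h2q : (1:ℝ) ≤ 2 ^ q := one_le_pow₀ (by norm_num)
    have e1 : ‖Rr f (ψ q) z‖ ≤ 4 * C * N ^ 2 / 2 ^ q := by
      refine (hPQ _).trans ?_
      have hρ := hS.rhoN z.1
      have hρ0 := hS.rho0 z.1
      have p1 : |P (Rr f (ψ q) z)| ≤ 2 * (N / 2 ^ q) ^ 2 := by
        have := abs_le.1 (hS.hP z)
        exact abs_le.2 ⟨by nlinarith, by nlinarith⟩
      have p2 : |Q (Rr f (ψ q) z)| ≤ 2 * (N / 2 ^ q) ^ 2 := by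
        have := abs_le.1 (hS.hQ z)
        exact abs_le.2 ⟨by nlinarith, by nlinarith⟩
      calc C * (|P (Rr f (ψ q) z)| + |Q (Rr f (ψ q) z)|)
          ≤ C * (2 * (N / 2 ^ q) ^ 2 + 2 * (N / 2 ^ q) ^ 2) := by gcongr
        _ = 4 * C * N ^ 2 / (2 ^ q * 2 ^ q) := by field_simp; ring
        _ ≤ 4 * C * N ^ 2 / 2 ^ q := by
          gcongr
          nlinarith
    have e2 : ‖f (dX (ψ q) z) - f (u z)‖ ≤ Kf * ((2 * K * N) / 2 ^ q) := by
      have := hLip.dist_le_mul _ (hmem _ (hub q z)) _ (hmem _ (hub' z))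
      rw [dist_eq_norm] at this
      refine this.trans ?_
      have := hdu q z
      gcongr
    have e3 : - dT (ψ q) z - f (u z) = Rr f (ψ q) z + (f (dX (ψ q) z) - f (u z)) := by
      rw [Rr]; abel
    rw [dist_eq_norm, e3]
    refine (norm_add_le _ _).trans ((add_le_add e1 e2).trans (le_of_eq ?_))
    rw [hC']; ring
  have hgeo : ∀ A : ℝ, Filter.Tendsto (fun q : ℕ => A / 2 ^ q) Filter.atTop (𝓝 0) := fun A => by
    have := (tendsto_pow_atTop_nhds_zero_of_lt_one (r := (1/2 : ℝ)) (by norm_num) (by norm_num)).const_mul A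
    simpa [div_eq_mul_inv] using this
  have hC'0 : 0 ≤ C' := by positivity
  have hends : ∀ q t x, 1 ≤ |t| → ψ q (t, x) = ψ0 (t, x) := by
    intro q
    induction q with
    | zero => intro t x _; rfl
    | succ q ih =>
      intro t x ht
      rw [← ih t x ht]
      exact hF2 q (sq q) t x ht
  have hcd : ∀ q, ContDiff ℝ ∞ (ψ q) := fun q => by
    obtain ⟨ϑ, h1, h2, hS⟩ := (sq q).2
    exact hS.cd
  refine ⟨ψ, u, hcd, ?_, ?_, ?_, ?_, ?_, ?_⟩
  · intro q
    obtain ⟨ϑ, h1, h2, hS⟩ := (sq q).2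
    exact hS.per
  · rw [Metric.tendstoUniformly_iff]
    intro ε hε
    filter_upwards [(hgeo (2 * K * N)).eventually (gt_mem_nhds hε)] with q hq z
    rw [dist_comm]; exact (hdu q z).trans_lt hq
  · rw [Metric.tendstoUniformly_iff]
    intro ε hε
    filter_upwards [(hgeo C').eventually (gt_mem_nhds hε)] with q hq z
    rw [dist_comm]; exact (hdF q z).trans_lt hq
  · exact fun z => hrV _ ((hub' z).trans hKr)
  · intro t x ht
    refine tendsto_nhds_unique (hu (t, x)) ?_
    have : ∀ q, dX (ψ q) (t, x) = 0 := fun q => by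
      obtain ⟨ϑ, h1, h2, hS⟩ := (sq q).2
      exact hS.ut t x ht
    simp only [this]
    exact tendsto_const_nhds
  · by_contra! hz
    have key : ∀ q : ℕ, ‖m • e‖ ≤ (2 * C') / 2 ^ q := by
      intro q
      have hder : ∀ t ∈ (Set.univ : Set ℝ), HasDerivWithinAt (fun t => ψ q (t, 0) + t • f 0)
          (dT (ψ q) (t, 0) + f 0) Set.univ t := by
        intro t _
        have e1 : HasDerivAt (fun t : ℝ => (t, (0:ℝ))) (1, 0) t :=
          (hasDerivAt_id t).prodMk (hasDerivAt_const t (0:ℝ))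
        have e2 := (((hcd q).differentiable (by simp)) (t, 0)).hasFDerivAt.comp_hasDerivAt t e1
        have e3 : HasDerivAt (fun t : ℝ => t • f 0) (f 0) t := by
          simpa using (hasDerivAt_id t).smul_const (f 0)
        exact (e2.add e3).hasDerivWithinAt
      have := convex_univ.norm_image_sub_le_of_norm_hasDerivWithin_le (C := C' / 2 ^ q) hder (by
        intro t _
        have := hdF q (t, 0)
        rw [hz (t, 0), dist_eq_norm, ← norm_neg] at this
        rw [add_comm]
        simpa using this) (Set.mem_univ (-1)) (Set.mem_univ 1)
      simp only [hends q 1 0 (by norm_num), hends q (-1) 0 (by norm_num), hψp, hψm] at this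
      have h2 : -f 0 - m • e + (1:ℝ) • f 0 - (f 0 + (-1:ℝ) • f 0) = -(m • e) := by module
      rw [h2, norm_neg] at this
      refine this.trans (le_of_eq ?_)
      norm_num; ring
    have : ‖m • e‖ ≤ 0 := ge_of_tendsto' (hgeo (2 * C')) key
    have h3 : m • e = 0 := norm_le_zero_iff.1 this
    have h4 : P (m • e) = m := by rw [map_smul, hPe]; simp
    rw [h3, map_zero] at h4
    exact hm.ne h4
end core

section core
open scoped ContDiff Topology

theorem weak_smooth {h φ : ℝ × ℝ → ℝ} (hh : ContDiff ℝ ∞ h) (hp : Per h) (hφ : ContDiff ℝ 1 φ)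
    (hφp : Per φ) {T : ℝ} (hT : ∀ t x, T ≤ |t| → φ (t, x) = 0) (hT0 : 0 < T) :
    (∫ t in (-T)..T, ∫ x in (0:ℝ)..1, (dX h (t, x) * dT φ (t, x) + -dT h (t, x) * dX φ (t, x)))
      = 0 := by
  have hdx := contDiff_dX hh
  have hdt := contDiff_dT hh
  have cφ : Continuous (fderiv ℝ φ) := hφ.continuous_fderiv (by simp)
  have dφ : ∀ z, HasFDerivAt φ (fderiv ℝ φ z) z :=
    fun z => (hφ.differentiable (by simp) z).hasFDerivAt
  have d1 : ∀ z, HasFDerivAt (dX h) (fderiv ℝ (dX h) z) z :=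
    fun z => (hdx.differentiable (by simp) z).hasFDerivAt
  have d2 : ∀ z, HasFDerivAt (dT h) (fderiv ℝ (dT h) z) z :=
    fun z => (hdt.differentiable (by simp) z).hasFDerivAt
  have sym : ∀ z, fderiv ℝ (dX h) z (1, 0) = fderiv ℝ (dT h) z (0, 1) := by
    intro z
    have hd : DifferentiableAt ℝ (fderiv ℝ h) z :=
      (hh.fderiv_right (m := ∞) (by simp)).differentiable (by simp) z
    have e1 : fderiv ℝ (dX h) z = (fderiv ℝ (fderiv ℝ h) z).flip (0, 1) := by
      have := hd.hasFDerivAt.clm_apply (hasFDerivAt_const ((0:ℝ), (1:ℝ)) z)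
      have := this.fderiv
      unfold dX
      rw [this]; ext <;> simp
    have e2 : fderiv ℝ (dT h) z = (fderiv ℝ (fderiv ℝ h) z).flip (1, 0) := by
      have := hd.hasFDerivAt.clm_apply (hasFDerivAt_const ((1:ℝ), (0:ℝ)) z)
      have := this.fderiv
      unfold dT
      rw [this]; ext <;> simp
    rw [e1, e2]
    simp only [ContinuousLinearMap.flip_apply]
    exact (hh.contDiffAt.isSymmSndFDerivAt (by simp only [minSmoothness_of_isRCLikeNormedField]; exact WithTop.coe_le_coe.2 (le_top : (2 : ℕ∞) ≤ ⊤))).eq _ _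
  have H := integral2_divergence_prod_of_hasFDerivAt (fun z => dX h z * φ z)
    (fun z => - dT h z * φ z)
    (fun z => dX h z • fderiv ℝ φ z + φ z • fderiv ℝ (dX h) z)
    (fun z => (- dT h z) • fderiv ℝ φ z + φ z • (-fderiv ℝ (dT h) z)) (-T) 0 T 1
    (hdx.continuous.mul hφ.continuous).continuousOn
    (hdt.continuous.neg.mul hφ.continuous).continuousOn
    (fun z _ => (d1 z).mul (dφ z)) (fun z _ => (d2 z).neg.mul (dφ z))
    (by
      refine ContinuousOn.integrableOn_compact (isCompact_uIcc.prod isCompact_uIcc) ?_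
      have c1 := hdx.continuous_fderiv (by simp)
      have c2 := hdt.continuous_fderiv (by simp)
      have c3 := hdx.continuous
      have c4 := hdt.continuous
      have c5 := hφ.continuous
      refine Continuous.continuousOn ?_
      fun_prop)
  have hpt : ∀ t, dT h (t, 1) = dT h (t, 0) := fun t => by simpa using hp.dT t 0
  have hpf : ∀ t, φ (t, 1) = φ (t, 0) := fun t => by simpa using hφp t 0
  have z1 : ∀ x, φ (T, x) = 0 := fun x => hT T x (le_abs_self T)
  have z2 : ∀ x, φ (-T, x) = 0 := fun x => hT (-T) x (by rw [abs_neg]; exact le_abs_self T)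
  simp only [hpt, hpf, z1, z2, sub_self, mul_zero, intervalIntegral.integral_zero, add_zero] at H
  rw [← H]
  congr 1; ext t; congr 1; ext x
  simp only [add_apply, smul_apply, smul_eq_mul,
    neg_apply, sym]
  simp only [dX, dT]
  ring

set_option maxHeartbeats 1000000 in
theorem isDistSol_of_limit {f : E2 → E2} {ψ : ℕ → ℝ × ℝ → E2} {u : ℝ × ℝ → E2}
    (hs : ∀ q, ContDiff ℝ ∞ (ψ q)) (hp : ∀ q, Per (ψ q))
    (h1 : TendstoUniformly (fun q => dX (ψ q)) u Filter.atTop)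
    (h2 : TendstoUniformly (fun q z => - dT (ψ q) z) (fun z => f (u z)) Filter.atTop) :
    IsDistSol f u := by
  intro φ hφ hφp ⟨T0, hT0⟩ i
  have cφ : Continuous (fderiv ℝ φ) := hφ.continuous_fderiv (by simp)
  have cu : Continuous u := h1.continuous (Filter.Frequently.of_forall
    fun q => (contDiff_dX (hs q)).continuous)
  have cf : Continuous (fun z => f (u z)) := h2.continuous (Filter.Frequently.of_forall
    fun q => (contDiff_dT (hs q)).continuous.neg)
  have prc : ∀ i : Fin 2, Continuous (fun v : E2 => v i) := fun i =>
    (EuclideanSpace.proj i : E2 →L[ℝ] ℝ).continuous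
  have cT : Continuous (fun z => fderiv ℝ φ z (1, 0)) := cφ.clm_apply continuous_const
  have cX : Continuous (fun z => fderiv ℝ φ z (0, 1)) := cφ.clm_apply continuous_const
  obtain ⟨T, hTpos, hTT⟩ : ∃ T : ℝ, 0 < T ∧ T0 < T := ⟨max T0 0 + 1, by positivity,
    by linarith [le_max_left T0 0]⟩
  have hd0 : ∀ t x, T ≤ |t| → fderiv ℝ φ (t, x) = 0 := by
    intro t x ht
    have : φ =ᶠ[𝓝 (t, x)] fun _ => (0:ℝ) := by
      have ho : IsOpen {z : ℝ × ℝ | T0 < |z.1|} := isOpen_lt continuous_const (by fun_prop)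
      filter_upwards [ho.mem_nhds (show T0 < |(t, x).1| from hTT.trans_le ht)] with z hz
      exact hT0 z.1 z.2 (le_of_lt hz)
    rw [this.fderiv_eq]; simp
  set F : ℝ → ℝ → ℝ := fun t x => u (t, x) i * fderiv ℝ φ (t, x) (1, 0)
            + f (u (t, x)) i * fderiv ℝ φ (t, x) (0, 1) with hF
  have cF : Continuous (Function.uncurry F) := by
    have : Continuous fun z : ℝ × ℝ => u z i * fderiv ℝ φ z (1, 0)
            + f (u z) i * fderiv ℝ φ z (0, 1) :=
      (((prc i).comp cu).mul cT).add (((prc i).comp cf).mul cX)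
    exact this
  have r1 : (∫ t : ℝ, ∫ x in Set.Ioc (0 : ℝ) 1, F t x) = ∫ t in (-T)..T, ∫ x in (0:ℝ)..1, F t x := by
    rw [intervalIntegral.integral_of_le (by linarith),
      setIntegral_eq_integral_of_forall_compl_eq_zero]
    · simp_rw [intervalIntegral.integral_of_le (zero_le_one' ℝ)]
    · intro t ht
      have : T ≤ |t| := by
        by_contra! hc
        rw [abs_lt] at hc
        exact ht ⟨hc.1, hc.2.le⟩
      simp [hF, hd0 t _ this]
  have key : ∀ q, (∫ t in (-T)..T, ∫ x in (0:ℝ)..1, (dX (ψ q) (t, x) i * dT φ (t, x)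
      + -dT (ψ q) (t, x) i * dX φ (t, x))) = 0 := by
    intro q
    have hc : ∀ z, HasFDerivAt (fun z => ψ q z i)
        ((EuclideanSpace.proj i : E2 →L[ℝ] ℝ).comp (fderiv ℝ (ψ q) z)) z := fun z =>
      ((EuclideanSpace.proj i : E2 →L[ℝ] ℝ).hasFDerivAt).comp z
        ((hs q).differentiable (by simp) z).hasFDerivAt
    have := weak_smooth (h := fun z => ψ q z i) (φ := φ)
      ((EuclideanSpace.proj i : E2 →L[ℝ] ℝ).contDiff.comp (hs q))
      (fun t x => by simp only [hp q t x]) hφ hφp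
      (fun t x ht => hT0 t x (hTT.le.trans ht)) hTpos
    have e1 : ∀ z, dX (fun z => ψ q z i) z = dX (ψ q) z i := fun z => by
      unfold dX; rw [(hc z).fderiv]; rfl
    have e2 : ∀ z, dT (fun z => ψ q z i) z = dT (ψ q) z i := fun z => by
      unfold dT; rw [(hc z).fderiv]; rfl
    simp only [e1, e2] at this
    exact this
  obtain ⟨M, hM⟩ := (isCompact_Icc.prod isCompact_Icc :
    IsCompact (Set.Icc (-T) T ×ˢ Set.Icc (0:ℝ) 1)).exists_bound_of_continuousOn
      (f := fun z => |dT φ z| + |dX φ z|) (by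
        exact (cT.abs.add cX.abs).continuousOn)
  have M0 : 0 ≤ M := (norm_nonneg _).trans (hM (0, 0) ⟨⟨by simp; linarith, by simpa using hTpos.le⟩, by simp⟩)
  rw [r1]
  have bound : ∀ η > 0, |∫ t in (-T)..T, ∫ x in (0:ℝ)..1, F t x| ≤ η * (M * (2 * T)) := by
    intro η hη
    rw [Metric.tendstoUniformly_iff] at h1 h2
    obtain ⟨q, hq1, hq2⟩ := ((h1 η hη).and (h2 η hη)).exists
    set Fq : ℝ → ℝ → ℝ := fun t x => dX (ψ q) (t, x) i * dT φ (t, x)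
      + -dT (ψ q) (t, x) i * dX φ (t, x) with hFq
    have cFq : Continuous (Function.uncurry Fq) := by
      have c1 := (contDiff_dX (hs q)).continuous
      have c2 := (contDiff_dT (hs q)).continuous
      have : Continuous fun z : ℝ × ℝ => dX (ψ q) z i * fderiv ℝ φ z (1, 0)
            + -dT (ψ q) z i * fderiv ℝ φ z (0, 1) :=
        (((prc i).comp c1).mul cT).add (((prc i).comp c2).neg.mul cX)
      exact this
    have e : (∫ t in (-T)..T, ∫ x in (0:ℝ)..1, F t x)
        = ∫ t in (-T)..T, ∫ x in (0:ℝ)..1, (F t x - Fq t x) := by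
      have i1 : IntervalIntegrable (fun t => ∫ x in (0:ℝ)..1, F t x) volume (-T) T :=
        (intervalIntegral.continuous_parametric_intervalIntegral_of_continuous' cF 0 1).intervalIntegrable _ _
      have i2 : IntervalIntegrable (fun t => ∫ x in (0:ℝ)..1, Fq t x) volume (-T) T :=
        (intervalIntegral.continuous_parametric_intervalIntegral_of_continuous' cFq 0 1).intervalIntegrable _ _
      have := intervalIntegral.integral_sub i1 i2
      rw [key q, sub_zero] at this
      rw [← this]
      congr 1; ext t
      rw [intervalIntegral.integral_sub]
      · exact (cF.comp (Continuous.prodMk_right t)).intervalIntegrable _ _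
      · exact (cFq.comp (Continuous.prodMk_right t)).intervalIntegrable _ _
    rw [e]
    have := intervalIntegral.norm_integral_le_of_norm_le_const (a := -T) (b := T) (C := η * M)
      (f := fun t => ∫ x in (0:ℝ)..1, (F t x - Fq t x)) (by
        intro t ht
        rw [Set.uIoc_of_le (by linarith)] at ht
        have := intervalIntegral.norm_integral_le_of_norm_le_const (a := 0) (b := 1) (C := η * M)
          (f := fun x => F t x - Fq t x) (by
          intro x hx
          rw [Set.uIoc_of_le zero_le_one] at hx
          have b1 : |u (t, x) i - dX (ψ q) (t, x) i| ≤ η := by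
            have := (PiLp.norm_apply_le (u (t, x) - dX (ψ q) (t, x)) i)
            rw [← dist_eq_norm] at this
            exact this.trans (hq1 _).le
          have b2 : |f (u (t, x)) i + dT (ψ q) (t, x) i| ≤ η := by
            have := (PiLp.norm_apply_le (f (u (t, x)) - -dT (ψ q) (t, x)) i)
            rw [← dist_eq_norm] at this
            have := this.trans (hq2 _).le
            simpa using this
          have b3 := hM (t, x) ⟨⟨ht.1.le, ht.2⟩, ⟨hx.1.le, hx.2⟩⟩
          rw [Real.norm_eq_abs, abs_of_nonneg (by positivity)] at b3
          have : F t x - Fq t x = (u (t, x) i - dX (ψ q) (t, x) i) * dT φ (t, x)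
            + (f (u (t, x)) i + dT (ψ q) (t, x) i) * dX φ (t, x) := by
            simp only [hF, hFq, dT, dX]; ring
          rw [this, Real.norm_eq_abs]
          calc _ ≤ |u (t, x) i - dX (ψ q) (t, x) i| * |dT φ (t, x)|
              + |f (u (t, x)) i + dT (ψ q) (t, x) i| * |dX φ (t, x)| := by
                rw [← abs_mul, ← abs_mul]; exact abs_add_le _ _
            _ ≤ η * |dT φ (t, x)| + η * |dX φ (t, x)| := by gcongr
            _ = η * (|dT φ (t, x)| + |dX φ (t, x)|) := by ring
            _ ≤ η * M := by gcongr)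
        simpa using this)
    rw [Real.norm_eq_abs] at this
    refine this.trans (le_of_eq ?_)
    rw [show T - -T = 2 * T by ring, abs_of_pos (by positivity)]; ring
  by_contra hne
  have hpos := abs_pos.2 hne
  have hK : 0 < M * (2 * T) + 1 := by positivity
  have := bound (|∫ t in (-T)..T, ∫ x in (0:ℝ)..1, F t x| / 2 / (M * (2 * T) + 1)) (by positivity)
  have h3 : |∫ t in (-T)..T, ∫ x in (0:ℝ)..1, F t x| / 2 / (M * (2 * T) + 1) * (M * (2 * T))
      ≤ |∫ t in (-T)..T, ∫ x in (0:ℝ)..1, F t x| / 2 := by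
    rw [div_mul_eq_mul_div, div_le_iff₀ hK]
    nlinarith
  linarith
end core

section core
open scoped ContDiff Topology
/-- The functional `v ↦ c * dot2 l v`. -/
def dotL (c : ℝ) (l : E2) : E2 →L[ℝ] ℝ :=
  c • (l 0 • (EuclideanSpace.proj 0 : E2 →L[ℝ] ℝ) + l 1 • (EuclideanSpace.proj 1 : E2 →L[ℝ] ℝ))

theorem dotL_apply (c : ℝ) (l v : E2) : dotL c l v = c * dot2 l v := by
  simp [dotL, dot2]; ring

theorem dot2_comm (a b : E2) : dot2 a b = dot2 b a := by unfold dot2; ring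

theorem dot2_smul (l v : E2) (c : ℝ) : dot2 l (c • v) = c * dot2 l v := by
  simp [dot2]; ring

theorem dot2_sub (l v w : E2) : dot2 l (v - w) = dot2 l v - dot2 l w := by
  simp [dot2]; ring

theorem dot2_decomp {rm rp lm lp : E2} (hmm : dot2 lm rm = 1) (hpp : dot2 lp rp = 1)
    (hmp : dot2 lm rp = 0) (hpm : dot2 lp rm = 0) (v : E2) :
    v = dot2 lm v • rm + dot2 lp v • rp := by
  have hd : (lm 0 * lp 1 - lm 1 * lp 0) * (rm 0 * rp 1 - rm 1 * rp 0) = 1 := by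
    unfold dot2 at *
    linear_combination (lp 0 * rp 0 + lp 1 * rp 1) * hmm + hpp - (lp 0 * rm 0 + lp 1 * rm 1) * hmp
  have hne : lm 0 * lp 1 - lm 1 * lp 0 ≠ 0 := left_ne_zero_of_mul_eq_one hd
  set w := v - (dot2 lm v • rm + dot2 lp v • rp) with hw
  have w1 : dot2 lm w = 0 := by
    simp only [dot2, hw, PiLp.sub_apply, PiLp.add_apply, PiLp.smul_apply, smul_eq_mul] at *
    linear_combination -(lm 0 * v 0 + lm 1 * v 1) * hmm - (lp 0 * v 0 + lp 1 * v 1) * hmp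
  have w2 : dot2 lp w = 0 := by
    simp only [dot2, hw, PiLp.sub_apply, PiLp.add_apply, PiLp.smul_apply, smul_eq_mul] at *
    linear_combination -(lm 0 * v 0 + lm 1 * v 1) * hpm - (lp 0 * v 0 + lp 1 * v 1) * hpp
  have w0 : w = 0 := by
    unfold dot2 at w1 w2
    ext i
    fin_cases i
    · refine (mul_eq_zero.1 (?_ : (lm 0 * lp 1 - lm 1 * lp 0) * w 0 = 0)).resolve_left hne
      linear_combination lp 1 * w1 - lm 1 * w2
    · refine (mul_eq_zero.1 (?_ : (lm 0 * lp 1 - lm 1 * lp 0) * w 1 = 0)).resolve_left hne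
      linear_combination lm 0 * w2 - lp 0 * w1
  exact sub_eq_zero.1 w0

theorem nonunique_core {V : Set E2} {f : E2 → E2} {Λm Λp : E2 → ℝ} {rm rp : E2 → E2} {lm lp : E2}
    (hm : Fam V f Λm rm) (hp : Fam V f Λp rp) (hlt : Λm 0 < Λp 0)
    (nm : ‖rm 0‖ = 1) (np : ‖rp 0‖ = 1)
    (elm : ∀ w : E2, dot2 lm (fderiv ℝ f 0 w) = Λm 0 * dot2 lm w)
    (elp : ∀ w : E2, dot2 lp (fderiv ℝ f 0 w) = Λp 0 * dot2 lp w)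
    (hmm : dot2 lm (rm 0) = 1) (hpp : dot2 lp (rp 0) = 1)
    (km : 0 < dot2 (cD rm) lp) (kp : 0 < dot2 (cD rp) lm)
    (gm : |cG Λm rm| ≤ 1 / 512 * dot2 (cD rp) lm * (Λp 0 - Λm 0))
    (gp : |cG Λp rp| ≤ 1 / 512 * dot2 (cD rm) lp * (Λp 0 - Λm 0)) :
    ∃ (ψ : ℕ → ℝ × ℝ → E2) (u : ℝ × ℝ → E2), (∀ q, ContDiff ℝ ∞ (ψ q)) ∧ (∀ q, Per (ψ q)) ∧
      TendstoUniformly (fun q => dX (ψ q)) u Filter.atTop ∧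
      TendstoUniformly (fun q z => - dT (ψ q) z) (fun z => f (u z)) Filter.atTop ∧
      (∀ z, u z ∈ V) ∧ (∀ t x, 1 ≤ |t| → u (t, x) = 0) ∧ ∃ z, u z ≠ 0 := by
  have hmp : dot2 lm (rp 0) = 0 := by
    have h1 := elm (rp 0)
    rw [hp.eig 0 hp.zero_mem, dot2_smul] at h1
    have : (Λp 0 - Λm 0) * dot2 lm (rp 0) = 0 := by linarith
    exact (mul_eq_zero.1 this).resolve_left (by linarith)
  have hpm : dot2 lp (rm 0) = 0 := by
    have h1 := elp (rm 0)
    rw [hm.eig 0 hm.zero_mem, dot2_smul] at h1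
    have : (Λp 0 - Λm 0) * dot2 lp (rm 0) = 0 := by linarith
    exact (mul_eq_zero.1 this).resolve_left (by linarith)
  have hd : 0 < Λp 0 - Λm 0 := by linarith
  rw [dot2_comm] at km kp
  rw [dot2_comm (cD rp)] at gm
  rw [dot2_comm (cD rm)] at gp
  set d := Λp 0 - Λm 0 with hdd
  set k1 := dot2 lm (cD rp) with hk1
  set k2 := dot2 lp (cD rm) with hk2
  have cp : 0 < d * k1 := mul_pos hd kp
  have cm : 0 < d * k2 := mul_pos hd km
  have H : TwoFam V f Λp rp Λm rm (dotL (d * k1)⁻¹ lm) (dotL (-(d * k2)⁻¹) lp) := by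
    refine ⟨hp, hm, ?_, ?_, ?_, ?_, ?_, ?_, ?_, ?_⟩
    · rw [dotL_apply, cC, dot2_sub, dot2_smul, elm, ← sub_mul, ← hdd, ← hk1]
      exact inv_mul_cancel₀ cp.ne'
    · rw [dotL_apply, cC, dot2_sub, dot2_smul, elp]; ring
    · rw [dotL_apply, cC, dot2_sub, dot2_smul, elm]; ring
    · rw [dotL_apply, cC, dot2_sub, dot2_smul, elp, ← sub_mul, ← hk2]
      rw [show Λm 0 - Λp 0 = -d by rw [hdd]; ring]
      rw [neg_mul, neg_mul, mul_neg, neg_neg]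
      exact inv_mul_cancel₀ cm.ne'
    · rw [dotL_apply, hmp, mul_zero]
    · rw [dotL_apply, hpm, mul_zero]
    · rw [dotL_apply, hpp, mul_one, abs_neg, abs_of_pos (inv_pos.2 cm), inv_mul_le_iff₀ cm]
      linarith
    · rw [dotL_apply, hmm, mul_one, abs_of_pos (inv_pos.2 cp), inv_mul_le_iff₀ cp]
      linarith
  refine H.iterate (C := d * k1 + d * k2) (by positivity) ?_
  intro v
  have b1 : |dot2 lm v| = d * k1 * |dotL (d * k1)⁻¹ lm v| := by
    rw [dotL_apply, abs_mul, abs_of_pos (inv_pos.2 cp), mul_inv_cancel_left₀ cp.ne']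
  have b2 : |dot2 lp v| = d * k2 * |dotL (-(d * k2)⁻¹) lp v| := by
    rw [dotL_apply, abs_mul, abs_neg, abs_of_pos (inv_pos.2 cm), mul_inv_cancel_left₀ cm.ne']
  have b3 : ‖v‖ ≤ |dot2 lm v| + |dot2 lp v| := by
    conv_lhs => rw [dot2_decomp hmm hpp hmp hpm v]
    refine (norm_add_le _ _).trans (le_of_eq ?_)
    rw [norm_smul, norm_smul, nm, np, mul_one, mul_one, Real.norm_eq_abs, Real.norm_eq_abs]
  rw [b1, b2] at b3
  nlinarith [abs_nonneg (dotL (d * k1)⁻¹ lm v), abs_nonneg (dotL (-(d * k2)⁻¹) lp v)]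

theorem isDistSol_zero (f : E2 → E2) : IsDistSol f (fun _ => 0) := by
  have e : ∀ z, fderiv ℝ (fun z : ℝ × ℝ => -(z.1 • f 0)) z
      = -((ContinuousLinearMap.fst ℝ ℝ ℝ).smulRight (f 0)) := by
    intro z
    exact (((ContinuousLinearMap.fst ℝ ℝ ℝ).smulRight (f 0)).hasFDerivAt (x := z)).neg.fderiv
  refine isDistSol_of_limit (ψ := fun _ z => -(z.1 • f 0)) (fun _ => by fun_prop)
    (fun _ t x => rfl) ?_ ?_
  · have : dX (fun z : ℝ × ℝ => -(z.1 • f 0)) = fun _ => 0 := by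
      ext1 z; simp [dX, e]
    simp only [this]
    exact Metric.tendstoUniformly_iff.2 fun ε hε => by simp [hε]
  · have : ∀ z, -dT (fun z : ℝ × ℝ => -(z.1 • f 0)) z = f 0 := by
      intro z; simp [dT, e]
    simp only [this]
    exact Metric.tendstoUniformly_iff.2 fun ε hε => by simp [hε]

theorem isDistSol_shift {f : E2 → E2} {ψ : ℕ → ℝ × ℝ → E2} {u : ℝ × ℝ → E2}
    (hs : ∀ q, ContDiff ℝ ∞ (ψ q)) (hp : ∀ q, Per (ψ q))
    (h1 : TendstoUniformly (fun q => dX (ψ q)) u Filter.atTop)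
    (h2 : TendstoUniformly (fun q z => - dT (ψ q) z) (fun z => f (u z)) Filter.atTop) (a : ℝ × ℝ) :
    IsDistSol f (fun z => u (z + a)) := by
  refine isDistSol_of_limit (ψ := fun q z => ψ q (z + a))
    (fun q => (hs q).comp (contDiff_id.add contDiff_const)) ?_ ?_ ?_
  · intro q t x
    have := hp q (t + a.1) (x + a.2)
    have e1 : ((t, x + 1) + a : ℝ × ℝ) = (t + a.1, x + a.2 + 1) := by
      ext <;> simp; ring
    have e2 : ((t, x) + a : ℝ × ℝ) = (t + a.1, x + a.2) := rfl
    simp only [e1, e2, this]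
  · have e : ∀ q, dX (fun z => ψ q (z + a)) = dX (ψ q) ∘ fun z => z + a := fun q => by
      ext1 z
      simp only [dX, Function.comp_apply]
      rw [fderiv_comp_add_right]
    simp only [e]
    exact h1.comp (fun z => z + a)
  · have e : ∀ q z, dT (fun z => ψ q (z + a)) z = dT (ψ q) (z + a) := fun q z => by
      simp only [dT]
      rw [fderiv_comp_add_right]
    simp only [e]
    exact h2.comp (fun z => z + a)
end core

/-- there is `ε > 0` such that every `2×2` strictly hyperbolic system of
conservation laws satisfying condition `C_ε` admits two continuous functions
`u⁽¹⁾, u⁽²⁾ ∈ C⁰(ℝ × 𝕋; ℝ²)` with values in `V`, each a distributional solution of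
`∂ₜu + ∂ₓ f(u) = 0` on `ℝ × 𝕋`, which agree for all `t ≤ -2` yet differ at `(0,0)`. -/
theorem dephasing_nonuniqueness :
    ∃ ε : ℝ, 0 < ε ∧
      ∀ (V : Set E2) (f : E2 → E2) (Λm Λp : E2 → ℝ) (rm rp : E2 → E2) (lm lp : E2),
        IsOpen V → (0 : E2) ∈ V →
        ContDiffOn ℝ (⊤ : ℕ∞) f V →
        ContDiffOn ℝ (⊤ : ℕ∞) Λm V → ContDiffOn ℝ (⊤ : ℕ∞) Λp V →
        ContDiffOn ℝ (⊤ : ℕ∞) rm V → ContDiffOn ℝ (⊤ : ℕ∞) rp V →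
        (∀ v ∈ V, Λm v < Λp v) →
        (∀ v ∈ V, ‖rm v‖ = 1) → (∀ v ∈ V, ‖rp v‖ = 1) →
        (∀ v ∈ V, fderiv ℝ f v (rm v) = Λm v • rm v) →
        (∀ v ∈ V, fderiv ℝ f v (rp v) = Λp v • rp v) →
        (∀ w : E2, dot2 lm (fderiv ℝ f 0 w) = Λm 0 * dot2 lm w) →
        (∀ w : E2, dot2 lp (fderiv ℝ f 0 w) = Λp 0 * dot2 lp w) →
        dot2 lm (rm 0) = 1 → dot2 lp (rp 0) = 1 →
        -- condition C_ε: κ₋ > 0, κ₊ > 0,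
        -- |(∇Λ⁻·r₋)(0)| ≤ ε κ₊ δΛ / A and |(∇Λ⁺·r₊)(0)| ≤ ε κ₋ δΛ / A
        0 < |det2 (rm 0) (rp 0)| * dot2 (fderiv ℝ rm 0 (rm 0)) lp →
        0 < |det2 (rm 0) (rp 0)| * dot2 (fderiv ℝ rp 0 (rp 0)) lm →
        |fderiv ℝ Λm 0 (rm 0)| ≤
          ε * (|det2 (rm 0) (rp 0)| * dot2 (fderiv ℝ rp 0 (rp 0)) lm) * (Λp 0 - Λm 0)
            / |det2 (rm 0) (rp 0)| →
        |fderiv ℝ Λp 0 (rp 0)| ≤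
          ε * (|det2 (rm 0) (rp 0)| * dot2 (fderiv ℝ rm 0 (rm 0)) lp) * (Λp 0 - Λm 0)
            / |det2 (rm 0) (rp 0)| →
        ∃ u₁ u₂ : ℝ × ℝ → E2,
          Continuous u₁ ∧ Continuous u₂ ∧
          (∀ t x, u₁ (t, x + 1) = u₁ (t, x)) ∧
          (∀ t x, u₂ (t, x + 1) = u₂ (t, x)) ∧
          (∀ z : ℝ × ℝ, u₁ z ∈ V) ∧ (∀ z : ℝ × ℝ, u₂ z ∈ V) ∧
          IsDistSol f u₁ ∧ IsDistSol f u₂ ∧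
          (∀ t x : ℝ, t ≤ -2 → u₁ (t, x) = u₂ (t, x)) ∧
          u₁ (0, 0) ≠ u₂ (0, 0) := by
  refine ⟨1 / 512, by norm_num, ?_⟩
  intro V f Λm Λp rm rp lm lp hV h0 hf hΛm hΛp hrm hrp hlt nm np em ep elm elp hmm hpp km kp gm gp
  have hA : 0 < |det2 (rm 0) (rp 0)| := by
    refine (abs_nonneg _).lt_of_ne fun h => ?_
    rw [← h, zero_mul] at km
    exact lt_irrefl _ km
  have km' := (mul_pos_iff_of_pos_left hA).1 km
  have kp' := (mul_pos_iff_of_pos_left hA).1 kp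
  obtain ⟨ψ, u, hs, hp, h1, h2, huV, hu0, ⟨⟨t0, x0⟩, hz⟩⟩ :=
    nonunique_core (V := V) (f := f) (Λm := Λm) (Λp := Λp) (rm := rm) (rp := rp) (lm := lm) (lp := lp)
      ⟨hV, h0, hf, hΛm, hrm, em⟩ ⟨hV, h0, hf, hΛp, hrp, ep⟩ (hlt 0 h0) (nm 0 h0) (np 0 h0)
      elm elp hmm hpp km' kp'
      (gm.trans (le_of_eq (by rw [div_eq_iff hA.ne']; unfold cD; ring)))
      (gp.trans (le_of_eq (by rw [div_eq_iff hA.ne']; unfold cD; ring)))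
  have cu : Continuous u := h1.continuous (Filter.Frequently.of_forall
    fun q => (contDiff_dX (hs q)).continuous)
  have pu : ∀ t x, u (t, x + 1) = u (t, x) := by
    intro t x
    have l1 := h1.tendsto_at (t, x + 1)
    have l2 := h1.tendsto_at (t, x)
    have : ∀ q, dX (ψ q) (t, x + 1) = dX (ψ q) (t, x) := fun q => (hp q).dX t x
    simp only [this] at l1
    exact tendsto_nhds_unique l1 l2
  have ht0 : |t0| < 1 := by
    by_contra! hc
    exact hz (hu0 t0 x0 hc)
  refine ⟨fun z => u (z + (t0, x0)), fun _ => 0, by fun_prop, continuous_const, ?_, fun _ _ => rfl,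
    fun z => huV _, fun _ => h0, isDistSol_shift hs hp h1 h2 _, isDistSol_zero f, ?_, ?_⟩
  · intro t x
    have := pu (t + t0) (x + x0)
    rw [show x + x0 + 1 = x + 1 + x0 by ring] at this
    exact this
  · intro t x ht
    refine hu0 (t + t0) (x + x0) ?_
    rw [abs_lt] at ht0
    rw [abs_of_neg (by linarith)]
    linarith
  · simpa using hz
end
end

section
/- Let f ∈ C^∞(ℝ; ℝ) and let u₁, u₂ ∈ C⁰([0,∞) × 𝕋; ℝ) be two continuous weak solutions of the scalar conservation law ∂ₜu + ∂ₓ f(u) = 0 with the same initial data u₁(0,·) = u₂(0,·). Then u₁ = u₂ on [0,∞) × 𝕋. -/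
open MeasureTheory

noncomputable section

/-- A continuous weak solution of the scalar conservation law `∂ₜu + ∂ₓ f(u) = 0` on
`[0,∞) × 𝕋`, the torus `𝕋 = ℝ/ℤ` being realized by `1`-periodic functions on `ℝ`:
`u` is continuous on `[0,∞) × ℝ`, `1`-periodic in `x`, bounded, and satisfies the weak
formulation against every `1`-periodic-in-`x` test function `φ ∈ C¹` with compact
support in time. -/
def IsScalarWeakSol (f : ℝ → ℝ) (u : ℝ × ℝ → ℝ) : Prop :=
  ContinuousOn u (Set.Ici (0 : ℝ) ×ˢ Set.univ) ∧
  (∀ t x, u (t, x + 1) = u (t, x)) ∧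
  (∃ M : ℝ, ∀ t x, 0 ≤ t → |u (t, x)| ≤ M) ∧
  ∀ φ : ℝ × ℝ → ℝ, ContDiff ℝ 1 φ →
    (∀ t x, φ (t, x + 1) = φ (t, x)) →
    (∃ T : ℝ, ∀ t x, T ≤ |t| → φ (t, x) = 0) →
    (∫ t in Set.Ioi (0 : ℝ), ∫ x in Set.Ioc (0 : ℝ) 1,
        (u (t, x) * fderiv ℝ φ (t, x) (1, 0) + f (u (t, x)) * fderiv ℝ φ (t, x) (0, 1)))
      + ∫ x in Set.Ioc (0 : ℝ) 1, u (0, x) * φ (0, x) = 0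

lemma time_lemma (A B : ℝ → ℝ) (hA : Continuous A) (hB : Continuous B)
    (h : ∀ χ χ' : ℝ → ℝ, Continuous χ' → (∀ t, HasDerivAt χ (χ' t) t) →
      (∃ T : ℝ, ∀ t, T ≤ |t| → χ t = 0) →
      (∫ t in Set.Ioi (0 : ℝ), (A t * χ' t + B t * χ t)) + A 0 * χ 0 = 0) :
    ∀ t, 0 ≤ t → A t - A 0 = ∫ s in (0:ℝ)..t, B s := by
  intro t ht
  obtain ⟨T, hT⟩ : ∃ T, T = t + 1 := ⟨_, rfl⟩
  have hT1 : 1 ≤ T := by linarith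
  have hP : ∀ s, HasDerivAt (fun s => ∫ r in (0:ℝ)..s, B r) (B s) s := fun s =>
    intervalIntegral.integral_hasDerivAt_right (hB.intervalIntegrable _ _)
      (hB.stronglyMeasurableAtFilter _ _) hB.continuousAt
  obtain ⟨P, hPdef⟩ : ∃ P : ℝ → ℝ, P = fun s => ∫ r in (0:ℝ)..s, B r := ⟨_, rfl⟩
  rw [← hPdef] at hP
  have hP0 : P 0 = 0 := by simp [hPdef]
  have hPc : Continuous P := continuous_iff_continuousAt.2 fun s => (hP s).continuousAt
  obtain ⟨Q, hQ⟩ : ∃ Q : ℝ → ℝ, Q = fun s => A s - A 0 - P s := ⟨_, rfl⟩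
  have hQc : Continuous Q := by rw [hQ]; fun_prop
  have hQ0 : Q 0 = 0 := by simp [hQ, hP0]
  obtain ⟨b, hb⟩ : ∃ b : ℝ → ℝ, b = fun s => max 0 (-s) * max 0 (s + 1) := ⟨_, rfl⟩
  have hbc : Continuous b := by rw [hb]; fun_prop
  obtain ⟨q, hq⟩ : ∃ q : ℝ → ℝ, q = fun s => max (T - s) 0 * Q (max s 0) := ⟨_, rfl⟩
  have hqc : Continuous q := by rw [hq]; fun_prop
  have hbpos : 0 < ∫ s in (-T)..T, b s := by
    apply intervalIntegral.integral_pos (by linarith) hbc.continuousOn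
    · intro s _; rw [hb]; positivity
    · refine ⟨-1/2, ⟨by linarith, by linarith⟩, ?_⟩
      rw [hb]; norm_num
  obtain ⟨c, hc⟩ : ∃ c, c = -(∫ s in (-T)..T, q s) / ∫ s in (-T)..T, b s := ⟨_, rfl⟩
  obtain ⟨g, hg⟩ : ∃ g : ℝ → ℝ, g = fun s => q s + c * b s := ⟨_, rfl⟩
  have hgc : Continuous g := by rw [hg]; fun_prop
  have hgint : ∫ s in (-T)..T, g s = 0 := by
    rw [hg, intervalIntegral.integral_add (hqc.intervalIntegrable _ _)
      ((hbc.const_mul c).intervalIntegrable _ _), intervalIntegral.integral_const_mul, hc]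
    field_simp
    ring
  have hgl : ∀ s, s ≤ -T → g s = 0 := by
    intro s hs
    have e1 : max s 0 = 0 := max_eq_right (by linarith)
    have e2 : max 0 (s+1) = 0 := max_eq_left (by linarith)
    simp [hg, hq, hb, e1, e2, hQ0]
  have hgr : ∀ s, T ≤ s → g s = 0 := by
    intro s hs
    have e1 : max (T - s) 0 = 0 := max_eq_right (by linarith)
    have e2 : max 0 (-s) = 0 := max_eq_left (by linarith)
    simp [hg, hq, hb, e1, e2]
  obtain ⟨χ, hχ⟩ : ∃ χ : ℝ → ℝ, χ = fun s => ∫ r in (-T)..s, g r := ⟨_, rfl⟩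
  have hχd : ∀ s, HasDerivAt χ (g s) s := fun s => by
    rw [hχ]
    exact intervalIntegral.integral_hasDerivAt_right (hgc.intervalIntegrable _ _)
      (hgc.stronglyMeasurableAtFilter _ _) hgc.continuousAt
  have hχc : Continuous χ := continuous_iff_continuousAt.2 fun s => (hχd s).continuousAt
  have hχr : ∀ s, T ≤ s → χ s = 0 := by
    intro s hs
    rw [hχ]
    simp only
    rw [← intervalIntegral.integral_add_adjacent_intervals (hgc.intervalIntegrable (-T) T)
      (hgc.intervalIntegrable T s), hgint, zero_add]
    apply intervalIntegral.integral_zero_ae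
    refine Filter.Eventually.of_forall fun r hr => hgr r ?_
    rw [Set.uIoc_of_le hs] at hr
    exact hr.1.le
  have hχl : ∀ s, s ≤ -T → χ s = 0 := by
    intro s hs
    rw [hχ]
    simp only
    apply intervalIntegral.integral_zero_ae
    refine Filter.Eventually.of_forall fun r hr => hgl r ?_
    rw [Set.uIoc_of_ge hs] at hr
    exact hr.2
  have key := h χ g hgc hχd ⟨T, fun s hs => by
    rcases le_abs.1 hs with h1 | h1
    · exact hχr s h1
    · exact hχl s (by linarith)⟩
  have e1 : ∫ t in Set.Ioi (0 : ℝ), (A t * g t + B t * χ t)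
      = ∫ t in (0:ℝ)..T, (A t * g t + B t * χ t) := by
    rw [intervalIntegral.integral_of_le (by linarith)]
    apply setIntegral_eq_of_subset_of_forall_sdiff_eq_zero measurableSet_Ioi
    · exact Set.Ioc_subset_Ioi_self
    · intro s hs
      have : T ≤ s := by
        by_contra hcon
        exact hs.2 ⟨hs.1, by linarith⟩
      simp [hgr s this, hχr s this]
  rw [e1, intervalIntegral.integral_add
    (Continuous.intervalIntegrable (u := fun t => A t * g t) (by fun_prop) _ _)
    (Continuous.intervalIntegrable (u := fun t => B t * χ t) (by fun_prop) _ _)] at key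
  have e2 : ∫ s in (0:ℝ)..T, P s * g s = P T * χ T - P 0 * χ 0 - ∫ s in (0:ℝ)..T, B s * χ s :=
    intervalIntegral.integral_mul_deriv_eq_deriv_mul (fun s _ => hP s) (fun s _ => hχd s)
      (hB.intervalIntegrable _ _) (hgc.intervalIntegrable _ _)
  have e3 : ∫ s in (0:ℝ)..T, g s = χ T - χ 0 :=
    intervalIntegral.integral_eq_sub_of_hasDerivAt (fun s _ => hχd s)
      (hgc.intervalIntegrable _ _)
  have e4 : ∫ s in (0:ℝ)..T, Q s * g s = (∫ s in (0:ℝ)..T, A s * g s)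
      - A 0 * (∫ s in (0:ℝ)..T, g s) - ∫ s in (0:ℝ)..T, P s * g s := by
    rw [← intervalIntegral.integral_const_mul, ← intervalIntegral.integral_sub,
      ← intervalIntegral.integral_sub]
    · apply intervalIntegral.integral_congr
      intro s _
      simp only [hQ]; ring
    all_goals exact Continuous.intervalIntegrable (by fun_prop) _ _
  have e5 : ∫ s in (0:ℝ)..T, Q s * g s = 0 := by
    rw [e4, e2, e3, hχr T le_rfl, hP0]; linarith
  have e6 : ∀ s ∈ Set.Icc 0 T, Q s * g s = (T - s) * Q s ^ 2 := by
    intro s hs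
    have e1 : max (T - s) 0 = T - s := max_eq_left (by linarith [hs.2])
    have e2 : max 0 (-s) = 0 := max_eq_left (by linarith [hs.1])
    have e3 : max s 0 = s := max_eq_left hs.1
    simp only [hg, hq, hb, e1, e2, e3]; ring
  have hQt : Q t = 0 := by
    by_contra hne
    have : 0 < ∫ s in (0:ℝ)..T, Q s * g s := by
      apply intervalIntegral.integral_pos (by linarith) (by fun_prop)
      · intro s hs
        rw [e6 s ⟨hs.1.le, hs.2⟩]
        exact mul_nonneg (by linarith [hs.2]) (sq_nonneg _)
      · refine ⟨t, ⟨ht, by linarith⟩, ?_⟩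
        rw [e6 t ⟨ht, by linarith⟩]
        have : T - t = 1 := by linarith
        rw [this]; positivity
    linarith
  simp only [hQ] at hQt
  have : P t = ∫ s in (0:ℝ)..t, B s := by rw [hPdef]
  linarith

lemma space_lemma (F G : ℝ → ℝ) (hF : Continuous F) (hG : Continuous G)
    (hFp : ∀ x, F (x + 1) = F x) (hGp : ∀ x, G (x + 1) = G x)
    (h : ∀ ψ ψ' : ℝ → ℝ, Continuous ψ' → (∀ x, HasDerivAt ψ (ψ' x) x) →
      (∀ x, ψ (x + 1) = ψ x) → (∀ x, ψ' (x + 1) = ψ' x) →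
      ∫ x in (0:ℝ)..1, F x * ψ x = ∫ x in (0:ℝ)..1, G x * ψ' x) :
    ∀ x, HasDerivAt G (- F x) x := by
  have hF0 : ∫ x in (0:ℝ)..1, F x = 0 := by
    have := h (fun _ => 1) (fun _ => 0) continuous_const (fun x => hasDerivAt_const _ _)
      (fun _ => rfl) (fun _ => rfl)
    simpa using this
  have prim : ∀ K : ℝ → ℝ, Continuous K → (∀ x, K (x + 1) = K x) →
      ∫ x in (0:ℝ)..1, K x = 0 → ∃ P : ℝ → ℝ, (∀ x, HasDerivAt P (K x) x) ∧
        ∀ x, P (x + 1) = P x := by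
    intro K hK hKp hK0
    refine ⟨fun x => ∫ y in (0:ℝ)..x, K y, fun x =>
      intervalIntegral.integral_hasDerivAt_right (hK.intervalIntegrable _ _)
      (hK.stronglyMeasurableAtFilter _ _) hK.continuousAt, fun x => ?_⟩
    simp only
    rw [← intervalIntegral.integral_add_adjacent_intervals (hK.intervalIntegrable 0 x)
      (hK.intervalIntegrable x (x+1)),
      Function.Periodic.intervalIntegral_add_eq (f := K) (T := 1) hKp x 0]
    simp [hK0]
  obtain ⟨P, hP, hPp⟩ := prim F hF hFp hF0
  have hPc : Continuous P := continuous_iff_continuousAt.2 fun s => (hP s).continuousAt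
  obtain ⟨m, hm⟩ : ∃ m, m = ∫ x in (0:ℝ)..1, (G x + P x) := ⟨_, rfl⟩
  obtain ⟨H, hH⟩ : ∃ H : ℝ → ℝ, H = fun x => G x + P x - m := ⟨_, rfl⟩
  have hHc : Continuous H := by rw [hH]; fun_prop
  have hHp : ∀ x, H (x + 1) = H x := by intro x; simp [hH, hGp, hPp]
  have hH0 : ∫ x in (0:ℝ)..1, H x = 0 := by
    rw [hH]
    rw [intervalIntegral.integral_sub
      (Continuous.intervalIntegrable (u := fun x => G x + P x) (by fun_prop) _ _)
      (continuous_const.intervalIntegrable _ _), ← hm]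
    simp
  obtain ⟨ψ, hψ, hψp⟩ := prim H hHc hHp hH0
  have hψc : Continuous ψ := continuous_iff_continuousAt.2 fun s => (hψ s).continuousAt
  have key := h ψ H hHc hψ hψp hHp
  have e2 : ∫ s in (0:ℝ)..1, P s * H s = P 1 * ψ 1 - P 0 * ψ 0 - ∫ s in (0:ℝ)..1, F s * ψ s :=
    intervalIntegral.integral_mul_deriv_eq_deriv_mul (fun s _ => hP s) (fun s _ => hψ s)
      (hF.intervalIntegrable _ _) (hHc.intervalIntegrable _ _)
  have p1 : P 1 = P 0 := by simpa using hPp 0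
  have p2 : ψ 1 = ψ 0 := by simpa using hψp 0
  have e4 : ∫ s in (0:ℝ)..1, H s * H s = (∫ s in (0:ℝ)..1, G s * H s)
      + (∫ s in (0:ℝ)..1, P s * H s) - m * ∫ s in (0:ℝ)..1, H s := by
    rw [← intervalIntegral.integral_const_mul, ← intervalIntegral.integral_add,
      ← intervalIntegral.integral_sub]
    · apply intervalIntegral.integral_congr
      intro s _
      simp only [hH]; ring
    all_goals exact Continuous.intervalIntegrable (by fun_prop) _ _
  have e5 : ∫ s in (0:ℝ)..1, H s * H s = 0 := by
    rw [e4, e2, p1, p2, hH0]; linarith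
  have hz : ∀ x ∈ Set.Icc (0:ℝ) 1, H x = 0 := by
    intro x hx
    by_contra hne
    have : 0 < ∫ s in (0:ℝ)..1, H s * H s := by
      apply intervalIntegral.integral_pos (by linarith) (by fun_prop)
      · intro s hs
        exact mul_self_nonneg _
      · exact ⟨x, hx, mul_self_pos.2 hne⟩
    linarith
  have hz' : ∀ x, H x = 0 := by
    intro x
    obtain ⟨y, hy, hxy⟩ := Function.Periodic.exists_mem_Ico₀ (f := H) (c := 1) hHp one_pos x
    rw [hxy]; exact hz y ⟨hy.1, hy.2.le⟩
  have hGe : G = fun x => m - P x := by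
    funext x
    have := hz' x
    simp only [hH] at this
    linarith
  intro x
  rw [hGe]
  exact (hP x).const_sub m

lemma max_lemma (W D E : ℝ → ℝ → ℝ) (hW : Continuous (fun p : ℝ × ℝ => W p.1 p.2))
    (hWp : ∀ t x, W t (x + 1) = W t x) (h0 : ∀ x, W 0 x = 0)
    (hx : ∀ t x, 0 ≤ t → HasDerivAt (fun y => W t y) (D t x) x)
    (ht : ∀ t x, 0 ≤ t → HasDerivAt (fun s => W s x) (E t x) t)
    (hDE : ∀ t x, 0 ≤ t → D t x = 0 → E t x = 0) :
    ∀ t x, 0 ≤ t → W t x ≤ 0 := by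
  intro T x hT
  suffices hε : ∀ ε > 0, W T x ≤ ε * T by
    rcases hT.eq_or_lt with h | h
    · rw [← h, h0]
    · apply le_of_forall_pos_le_add
      intro δ hδ
      have := hε (δ / T) (by positivity)
      rw [div_mul_cancel₀ _ h.ne'] at this
      linarith
  intro ε hε
  have hK : IsCompact (Set.Icc (0:ℝ) T ×ˢ Set.Icc (0:ℝ) 1) := isCompact_Icc.prod isCompact_Icc
  obtain ⟨⟨t0, x0⟩, ⟨ht0, hx0⟩, hmax⟩ := hK.exists_isMaxOn
    (f := fun p : ℝ × ℝ => W p.1 p.2 - ε * p.1) ⟨(0, 0), by simp [hT]⟩ (by fun_prop)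
  have hmax' : ∀ s y, 0 ≤ s → s ≤ T → W s y - ε * s ≤ W t0 x0 - ε * t0 := by
    intro s y hs hsT
    obtain ⟨z, hz, hyz⟩ := Function.Periodic.exists_mem_Ico₀ (f := W s) (c := 1) (hWp s) one_pos y
    rw [hyz]
    exact hmax (show (s, z) ∈ _ from ⟨⟨hs, hsT⟩, ⟨hz.1, hz.2.le⟩⟩)
  simp only at ht0 hx0
  rcases ht0.1.eq_or_lt with h | h
  · have := hmax' T x hT le_rfl
    rw [← h, h0] at this
    linarith
  · exfalso
    have hlm : IsLocalMax (fun y => W t0 y) x0 := by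
      refine Filter.Eventually.of_forall fun y => ?_
      have := hmax' t0 y ht0.1 ht0.2
      simp only
      linarith
    have hD := hlm.hasDerivAt_eq_zero (hx t0 x0 ht0.1)
    have hE := hDE _ _ ht0.1 hD
    have hd := (ht t0 x0 ht0.1).tendsto_slope
    rw [hE] at hd
    have hev := hd.eventually (gt_mem_nhds hε)
    have hev2 : ∀ᶠ s in nhdsWithin t0 (Set.Iio t0), slope (fun s => W s x0) t0 s < ε :=
      hev.filter_mono (nhdsWithin_mono _ fun s hs => ne_of_lt hs)
    have hev3 : ∀ᶠ s in nhdsWithin t0 (Set.Iio t0), s ∈ Set.Ioo 0 t0 := Ioo_mem_nhdsLT h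
    obtain ⟨s, hs1, hs2⟩ := (hev2.and hev3).exists
    have := hmax' s x0 hs2.1.le (hs2.2.le.trans ht0.2)
    rw [slope_def_field, div_lt_iff_of_neg (by linarith [hs2.2])] at hs1
    linarith

/-- Continuous extension to negative times. -/
def extU (u : ℝ × ℝ → ℝ) (t x : ℝ) : ℝ := u (max t 0, x)

lemma extU_cont {f : ℝ → ℝ} {u : ℝ × ℝ → ℝ} (h : IsScalarWeakSol f u) :
    Continuous (fun p : ℝ × ℝ => extU u p.1 p.2) := by
  refine h.1.comp_continuous (f := fun p : ℝ × ℝ => (max p.1 0, p.2)) (by fun_prop) ?_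
  intro p
  simp

lemma weak_product (f : ℝ → ℝ) (hf : Continuous f) (u : ℝ × ℝ → ℝ) (h : IsScalarWeakSol f u)
    (ψ ψ' : ℝ → ℝ) (hψ' : Continuous ψ') (hψ : ∀ x, HasDerivAt ψ (ψ' x) x)
    (hψp : ∀ x, ψ (x + 1) = ψ x) (t : ℝ) (ht : 0 ≤ t) :
    (∫ x in (0:ℝ)..1, extU u t x * ψ x) - (∫ x in (0:ℝ)..1, extU u 0 x * ψ x) =
      ∫ x in (0:ℝ)..1, (∫ s in (0:ℝ)..t, f (extU u s x)) * ψ' x := by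
  have hv := extU_cont h
  have hψc : Continuous ψ := continuous_iff_continuousAt.2 fun s => (hψ s).continuousAt
  have hc1 : Continuous (fun p : ℝ × ℝ => extU u p.1 p.2 * ψ p.2) := by fun_prop
  have hc2 : Continuous (fun p : ℝ × ℝ => f (extU u p.1 p.2) * ψ' p.2) := by fun_prop
  have hA : Continuous (fun t => ∫ x in (0:ℝ)..1, extU u t x * ψ x) :=
    intervalIntegral.continuous_parametric_intervalIntegral_of_continuous' hc1 0 1
  have hB : Continuous (fun t => ∫ x in (0:ℝ)..1, f (extU u t x) * ψ' x) :=
    intervalIntegral.continuous_parametric_intervalIntegral_of_continuous' hc2 0 1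
  have key := time_lemma _ _ hA hB ?_ t ht
  · rw [key, intervalIntegral_intervalIntegral_swap]
    · simp_rw [intervalIntegral.integral_mul_const]
    · have : IntegrableOn (fun p : ℝ × ℝ => f (extU u p.1 p.2) * ψ' p.2)
          (Set.uIcc 0 t ×ˢ Set.uIcc 0 1) :=
        hc2.continuousOn.integrableOn_compact (isCompact_uIcc.prod isCompact_uIcc)
      exact this.mono_set (Set.prod_mono Set.uIoc_subset_uIcc Set.uIoc_subset_uIcc)
  · intro χ χ' hχ' hχ hχs
    obtain ⟨T, hT⟩ := hχs
    have hC1 : ∀ g g' : ℝ → ℝ, Continuous g' → (∀ x, HasDerivAt g (g' x) x) →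
        ContDiff ℝ 1 g := by
      intro g g' hg' hg
      rw [contDiff_one_iff_deriv]
      refine ⟨fun x => (hg x).differentiableAt, ?_⟩
      have : deriv g = g' := funext fun x => (hg x).deriv
      rw [this]; exact hg'
    have hχC := hC1 χ χ' hχ' hχ
    have hψC := hC1 ψ ψ' hψ' hψ
    have hw := h.2.2.2 (fun p => χ p.1 * ψ p.2)
      ((hχC.comp contDiff_fst).mul (hψC.comp contDiff_snd))
      (fun t x => by simp [hψp]) ⟨T, fun t x htx => by simp [hT t htx]⟩
    have hfd : ∀ t x, HasFDerivAt (fun p : ℝ × ℝ => χ p.1 * ψ p.2)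
        (χ t • (ψ' x • ContinuousLinearMap.snd ℝ ℝ ℝ)
          + ψ x • (χ' t • ContinuousLinearMap.fst ℝ ℝ ℝ)) (t, x) := by
      intro t x
      exact ((hχ t).comp_hasFDerivAt (t, x) (hasFDerivAt_fst)).mul
        ((hψ x).comp_hasFDerivAt (t, x) (hasFDerivAt_snd))
    simp_rw [(hfd _ _).fderiv] at hw
    refine Eq.trans ?_ hw
    congr 1
    · apply setIntegral_congr_fun measurableSet_Ioi
      intro s hs
      have hs' : ∀ x, u (s, x) = extU u s x := fun x => by
        rw [extU, max_eq_left (le_of_lt hs)]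
      simp only [hs']
      rw [← intervalIntegral.integral_of_le zero_le_one, mul_comm, mul_comm _ (χ s),
        ← intervalIntegral.integral_const_mul, ← intervalIntegral.integral_const_mul,
        ← intervalIntegral.integral_add]
      · apply intervalIntegral.integral_congr
        intro x _
        simp
        ring
      · exact Continuous.intervalIntegrable (by fun_prop) _ _
      · exact Continuous.intervalIntegrable (by fun_prop) _ _
    · have hs' : ∀ x, u (0, x) = extU u 0 x := fun x => by simp [extU]
      simp only [hs']
      rw [← intervalIntegral.integral_of_le zero_le_one,
        ← intervalIntegral.integral_mul_const]
      apply intervalIntegral.integral_congr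
      intro x _
      simp only
      ring

/-- continuous weak solutions of a scalar 1D conservation law on the torus
are uniquely determined by their initial value. -/
theorem scalar_continuous_weak_solutions_unique
    (f : ℝ → ℝ) (hf : ContDiff ℝ (⊤ : ℕ∞) f)
    (u₁ u₂ : ℝ × ℝ → ℝ)
    (h₁ : IsScalarWeakSol f u₁) (h₂ : IsScalarWeakSol f u₂)
    (h0 : ∀ x, u₁ (0, x) = u₂ (0, x)) :
    ∀ t x, 0 ≤ t → u₁ (t, x) = u₂ (t, x) := by
  have hfc : Continuous f := hf.continuous
  have hv1 := extU_cont h₁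
  have hv2 := extU_cont h₂
  have hp1 : ∀ t x, extU u₁ t (x + 1) = extU u₁ t x := fun t x => h₁.2.1 _ _
  have hp2 : ∀ t x, extU u₂ t (x + 1) = extU u₂ t x := fun t x => h₂.2.1 _ _
  have hE : Continuous (fun p : ℝ × ℝ => f (extU u₁ p.1 p.2) - f (extU u₂ p.1 p.2)) := by
    fun_prop
  obtain ⟨W, hWd⟩ : ∃ W : ℝ → ℝ → ℝ, W = fun t x =>
    ∫ s in (0:ℝ)..t, (f (extU u₁ s x) - f (extU u₂ s x)) := ⟨_, rfl⟩
  have hW : Continuous (fun p : ℝ × ℝ => W p.1 p.2) := by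
    rw [hWd]
    exact intervalIntegral.continuous_parametric_intervalIntegral_of_continuous
      (f := fun (p : ℝ × ℝ) s => f (extU u₁ s p.2) - f (extU u₂ s p.2))
      (hE.comp (f := fun q : (ℝ × ℝ) × ℝ => (q.2, q.1.2)) (by fun_prop)) continuous_fst
  have hWp : ∀ t x, W t (x + 1) = W t x := by intro t x; simp only [hWd, hp1, hp2]
  have hW0 : ∀ x, W 0 x = 0 := by intro x; simp [hWd]
  have ht : ∀ t x, 0 ≤ t →
      HasDerivAt (fun s => W s x) (f (extU u₁ t x) - f (extU u₂ t x)) t := by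
    intro t x _
    have hc : Continuous (fun s => f (extU u₁ s x) - f (extU u₂ s x)) :=
      hE.comp (f := fun s : ℝ => (s, x)) (by fun_prop)
    rw [hWd]
    exact intervalIntegral.integral_hasDerivAt_right (hc.intervalIntegrable _ _)
      (hc.stronglyMeasurableAtFilter _ _) hc.continuousAt
  have hx : ∀ t x, 0 ≤ t →
      HasDerivAt (fun y => W t y) (-(extU u₁ t x - extU u₂ t x)) x := by
    intro t x ht
    have c1 : ∀ t, Continuous (extU u₁ t) := fun t =>
      hv1.comp (f := fun x : ℝ => (t, x)) (by fun_prop)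
    have c2 : ∀ t, Continuous (extU u₂ t) := fun t =>
      hv2.comp (f := fun x : ℝ => (t, x)) (by fun_prop)
    have hWt : Continuous (fun y => W t y) := hW.comp (f := fun x : ℝ => (t, x)) (by fun_prop)
    refine space_lemma (fun x => extU u₁ t x - extU u₂ t x) (fun y => W t y)
      ((c1 t).sub (c2 t)) hWt (fun x => by simp only [hp1, hp2]) (hWp t) ?_ x
    intro ψ ψ' hψ' hψ hψp _
    have hψc : Continuous ψ := continuous_iff_continuousAt.2 fun s => (hψ s).continuousAt
    have k1 := weak_product f hfc u₁ h₁ ψ ψ' hψ' hψ hψp t ht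
    have k2 := weak_product f hfc u₂ h₂ ψ ψ' hψ' hψ hψp t ht
    have h00 : ∀ x, extU u₁ 0 x = extU u₂ 0 x := fun x => by simp [extU, h0]
    simp only [h00] at k1
    have d : ∀ u : ℝ × ℝ → ℝ, Continuous (fun p : ℝ × ℝ => extU u p.1 p.2) →
        Continuous fun x => ∫ s in (0:ℝ)..t, f (extU u s x) := by
      intro u hu
      exact intervalIntegral.continuous_parametric_intervalIntegral_of_continuous'
        (f := fun x s => f (extU u s x))
        ((hfc.comp hu).comp (f := fun q : ℝ × ℝ => (q.2, q.1)) (by fun_prop)) 0 t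
    have d1 := d u₁ hv1
    have d2 := d u₂ hv2
    have l : ∫ x in (0:ℝ)..1, (extU u₁ t x - extU u₂ t x) * ψ x
        = (∫ x in (0:ℝ)..1, extU u₁ t x * ψ x) - ∫ x in (0:ℝ)..1, extU u₂ t x * ψ x := by
      rw [← intervalIntegral.integral_sub 
        (Continuous.intervalIntegrable (u := fun x => extU u₁ t x * ψ x) ((c1 t).mul hψc) _ _)
        (Continuous.intervalIntegrable (u := fun x => extU u₂ t x * ψ x) ((c2 t).mul hψc) _ _)]
      simp_rw [sub_mul]
    have r : ∫ x in (0:ℝ)..1, W t x * ψ' x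
        = (∫ x in (0:ℝ)..1, (∫ s in (0:ℝ)..t, f (extU u₁ s x)) * ψ' x)
          - ∫ x in (0:ℝ)..1, (∫ s in (0:ℝ)..t, f (extU u₂ s x)) * ψ' x := by
      rw [← intervalIntegral.integral_sub 
        (Continuous.intervalIntegrable
          (u := fun x => (∫ s in (0:ℝ)..t, f (extU u₁ s x)) * ψ' x) (d1.mul hψ') _ _)
        (Continuous.intervalIntegrable
          (u := fun x => (∫ s in (0:ℝ)..t, f (extU u₂ s x)) * ψ' x) (d2.mul hψ') _ _)]
      apply intervalIntegral.integral_congr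
      intro x _
      simp only [hWd]
      rw [intervalIntegral.integral_sub, sub_mul]
      · exact ((hfc.comp hv1).comp (f := fun s : ℝ => (s, x))
          (by fun_prop)).intervalIntegrable _ _
      · exact ((hfc.comp hv2).comp (f := fun s : ℝ => (s, x))
          (by fun_prop)).intervalIntegrable _ _
    rw [l, r]
    linarith
  have hle := max_lemma W _ _ hW hWp hW0 hx ht (fun t x _ hD => by
    have : extU u₁ t x = extU u₂ t x := by linarith
    rw [this, sub_self])
  have hge := max_lemma (fun t x => - W t x) _ _ hW.neg (fun t x => by simp only [hWp])
    (fun x => by simp [hW0]) (fun t x h => (hx t x h).neg) (fun t x h => (ht t x h).neg)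
    (fun t x _ hD => by
      have : extU u₁ t x = extU u₂ t x := by linarith
      rw [this, sub_self, neg_zero])
  intro t x htn
  have hWz : (fun y => W t y) = fun _ => 0 := by
    funext y
    have a := hle t y htn
    have b := hge t y htn
    linarith
  have hd := hx t x htn
  rw [hWz] at hd
  have := hd.unique (hasDerivAt_const x (0:ℝ))
  simp only [extU, max_eq_left htn] at this
  linarith
end
end
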